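/- Assume G contains no reflection of V~. Then G is a good normal subgroup of W~ if and only if G is contained in SL(V~) and, for every equivalence class C in A'bar(W~), the product alpha_C = prod over H in C of alpha_H lies in B^G. -/

import Mathlib

open MvPolynomial

noncomputable section

namespace ReflQuot

variable {k : Type} [Field k]

/-- The action of an invertible matrix `g` on polynomial functions on `k^n`:
the linear form `X i` is sent to `∑ j, (g⁻¹) i j • X j`, so that
`(g • f) (v) = f (g⁻¹ ⬝ v)`. -/
def matAct {n : ℕ} (g : Matrix.GeneralLinearGroup (Fin n) k) :
    MvPolynomial (Fin n) k →ₐ[k] MvPolynomial (Fin n) k :=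
  aeval fun i => ∑ j, ((↑(g⁻¹) : Matrix (Fin n) (Fin n) k) i j) • X j

/-- The algebra endomorphism of `k[X_1,…,X_m]` sending `X i` to `∑ j, M i j • X j`. -/
def polyAct {m : ℕ} (M : Fin m → Fin m → k) :
    MvPolynomial (Fin m) k →ₐ[k] MvPolynomial (Fin m) k :=
  aeval fun i => ∑ j, M i j • X j

/-- A reflection: an automorphism of finite order whose fixed-point subspace is a
hyperplane. -/
def IsReflection {n : ℕ} (M : Matrix (Fin n) (Fin n) k) : Prop :=
  IsOfFinOrder M ∧
    Module.finrank k (LinearMap.ker (Matrix.toLin' M - LinearMap.id)) + 1 = n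

/-- A double reflection: finite order, fixed points of codimension 2. -/
def IsDoubleReflection {n : ℕ} (M : Matrix (Fin n) (Fin n) k) : Prop :=
  IsOfFinOrder M ∧
    Module.finrank k (LinearMap.ker (Matrix.toLin' M - LinearMap.id)) + 2 = n

/-- A reflection group: a group generated by its reflections. -/
def IsReflectionGroup {n : ℕ} (W : Subgroup (Matrix.GeneralLinearGroup (Fin n) k)) : Prop :=
  Subgroup.closure {g | g ∈ W ∧ IsReflection ((g : Matrix (Fin n) (Fin n) k))} = W

/-- The algebra of `G`-invariant polynomials. -/
def invariants {n : ℕ} (G : Subgroup (Matrix.GeneralLinearGroup (Fin n) k)) :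
    Subalgebra k (MvPolynomial (Fin n) k) where
  carrier := {f | ∀ g ∈ G, matAct g f = f}
  mul_mem' := fun {a b} ha hb g hg => by
    rw [map_mul, ha g hg, hb g hg]
  one_mem' := fun g _ => map_one (matAct g)
  add_mem' := fun {a b} ha hb g hg => by
    rw [map_add, ha g hg, hb g hg]
  zero_mem' := fun g _ => map_zero (matAct g)
  algebraMap_mem' := fun r g _ => (matAct g).commutes r

/-- The linear span of products of two positive-degree invariants, i.e. `(B^G_+)^2`. -/
def sqSpan {n : ℕ} (G : Subgroup (Matrix.GeneralLinearGroup (Fin n) k)) :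
    Submodule k (MvPolynomial (Fin n) k) :=
  Submodule.span k {f | ∃ u ∈ invariants G, ∃ v ∈ invariants G,
    constantCoeff u = 0 ∧ constantCoeff v = 0 ∧ f = u * v}

/-- The ideal of positive-degree elements of the polynomial ring. -/
def idealPlus (k : Type) [Field k] (m : ℕ) : Ideal (MvPolynomial (Fin m) k) :=
  Ideal.span (Set.range X)

/-- The ideal `I` of relations between the generators `p i` of the invariant algebra:
the kernel of `k[V] = k[X_1,…,X_m] → B^G`, `X i ↦ p i`. -/
def relIdeal {n m : ℕ} (p : Fin m → MvPolynomial (Fin n) k) :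
    Ideal (MvPolynomial (Fin m) k) :=
  RingHom.ker (aeval p : MvPolynomial (Fin m) k →ₐ[k] MvPolynomial (Fin n) k)

/-- The context: `Wt` is a finite reflection group on `k^n`, `G` a normal subgroup of `Wt`,
`p` a minimal system of homogeneous generators (of degrees `d`) of the invariant algebra
`B^G` whose span is `Wt`-stable (i.e. a graded `W`-equivariant section of
`B^G_+ → B^G_+/(B^G_+)^2`), and `c w` the matrix of the action of `w` on the span of the
`p i`, giving the induced action of `W = Wt/G` on `V = k^m`. -/
structure QuotSetup {n m : ℕ} (Wt G : Subgroup (Matrix.GeneralLinearGroup (Fin n) k))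
    (p : Fin m → MvPolynomial (Fin n) k) (d : Fin m → ℕ)
    (c : ↥Wt → Fin m → Fin m → k) : Prop where
  finite : (Wt : Set (Matrix.GeneralLinearGroup (Fin n) k)).Finite
  reflGroup : IsReflectionGroup Wt
  le : G ≤ Wt
  normal : ∀ w ∈ Wt, ∀ g ∈ G, w * g * w⁻¹ ∈ G
  homog : ∀ i, (p i).IsHomogeneous (d i)
  dpos : ∀ i, 0 < d i
  gen : Algebra.adjoin k (Set.range p) = invariants G
  minimal : ∀ a : Fin m → k, (∑ i, a i • p i) ∈ sqSpan G → a = 0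
  equivar : ∀ (w : ↥Wt) (i), matAct (w : Matrix.GeneralLinearGroup (Fin n) k) (p i)
      = ∑ j, c w i j • p j

/-- `W = Wt/G` acts trivially on the conormal module `I/(A_+ I)`. -/
def TrivialConormal {n m : ℕ} (Wt : Subgroup (Matrix.GeneralLinearGroup (Fin n) k))
    (p : Fin m → MvPolynomial (Fin n) k) (c : ↥Wt → Fin m → Fin m → k) : Prop :=
  ∀ w : ↥Wt, ∀ f ∈ relIdeal p, polyAct (c w) f - f ∈ idealPlus k m * relIdeal p

/-- `G` is of complete intersection: `I` is generated by `dim V - dim Vt = m - n` elements. -/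
def IsCompleteIntersection {n m : ℕ} (p : Fin m → MvPolynomial (Fin n) k) : Prop :=
  ∃ s : Finset (MvPolynomial (Fin m) k), s.card = m - n ∧ Ideal.span (s : Set _) = relIdeal p

/-- `G` is a good normal subgroup of `Wt`. -/
def IsGoodQuot {n m : ℕ} (Wt : Subgroup (Matrix.GeneralLinearGroup (Fin n) k))
    (p : Fin m → MvPolynomial (Fin n) k) (c : ↥Wt → Fin m → Fin m → k) : Prop :=
  IsCompleteIntersection p ∧ TrivialConormal Wt p c


/-- The pointwise stabilizer of a subspace `L` in `GL_n(k)`. -/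
def pointStab {n : ℕ} (L : Submodule k (Fin n → k)) :
    Subgroup (Matrix.GeneralLinearGroup (Fin n) k) where
  carrier := {g | ∀ x ∈ L, Matrix.mulVec (g : Matrix (Fin n) (Fin n) k) x = x}
  one_mem' := fun x _ => Matrix.one_mulVec x
  mul_mem' := fun {a b} ha hb x hx => by
    rw [Units.val_mul, ← Matrix.mulVec_mulVec, hb x hx, ha x hx]
  inv_mem' := fun {a} ha x hx => by
    have h1 : Matrix.mulVec (↑(a⁻¹) : Matrix (Fin n) (Fin n) k)
        (Matrix.mulVec (↑a : Matrix (Fin n) (Fin n) k) x) = x := by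
      rw [Matrix.mulVec_mulVec, ← Units.val_mul, inv_mul_cancel, Units.val_one,
        Matrix.one_mulVec]
    rw [ha x hx] at h1
    exact h1

/-- The set of reflecting hyperplanes of a subgroup `W` of `GL_n(k)`. -/
def reflHyps {n : ℕ} (W : Subgroup (Matrix.GeneralLinearGroup (Fin n) k)) :
    Set (Submodule k (Fin n → k)) :=
  {H | ∃ g ∈ W, IsReflection ((g : Matrix (Fin n) (Fin n) k)) ∧
      H = LinearMap.ker (Matrix.toLin' ((g : Matrix (Fin n) (Fin n) k)) - LinearMap.id)}

/-- The set `A'(Wt)` of reflecting hyperplanes `H` of `Wt` such that `Wt_H ≠ G_H`. -/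
def reflHyps' {n : ℕ} (Wt G : Subgroup (Matrix.GeneralLinearGroup (Fin n) k)) :
    Set (Submodule k (Fin n → k)) :=
  {H | H ∈ reflHyps Wt ∧ ¬ (Wt ⊓ pointStab H ≤ G)}

/-- `Wt_H` and `Wt_{H'}` have the same image in `W = Wt/G`. -/
def imageEq {n : ℕ} (Wt G : Subgroup (Matrix.GeneralLinearGroup (Fin n) k))
    (H H' : Submodule k (Fin n → k)) : Prop :=
  {x | ∃ g ∈ G, ∃ u ∈ Wt ⊓ pointStab H, x = g * u}
    = {x | ∃ g ∈ G, ∃ u ∈ Wt ⊓ pointStab H', x = g * u}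

/-- `e_H = |G_H|`. -/
def eH {n : ℕ} (G : Subgroup (Matrix.GeneralLinearGroup (Fin n) k))
    (H : Submodule k (Fin n → k)) : ℕ :=
  Nat.card ↥(G ⊓ pointStab H)

/-- The map `p : Vt → V`, `x ↦ (p 1 (x), …, p m (x))`. -/
def pMap {n m : ℕ} (p : Fin m → MvPolynomial (Fin n) k) (x : Fin n → k) : Fin m → k :=
  fun i => eval x (p i)

/-- The matrix of the action of (the image in `W` of) `w` on `V = k^m`. -/
def qMat {n m : ℕ} {Wt : Subgroup (Matrix.GeneralLinearGroup (Fin n) k)}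
    (c : ↥Wt → Fin m → Fin m → k) (w : ↥Wt) : Matrix (Fin m) (Fin m) k :=
  Matrix.of (c w⁻¹)

/-- The set of reflecting hyperplanes of `W = Wt/G` acting on `V = k^m`. -/
def reflHypsV {n m : ℕ} {Wt : Subgroup (Matrix.GeneralLinearGroup (Fin n) k)}
    (c : ↥Wt → Fin m → Fin m → k) : Set (Submodule k (Fin m → k)) :=
  {K | ∃ w : ↥Wt, IsReflection (qMat c w) ∧
      K = LinearMap.ker (Matrix.toLin' (qMat c w) - LinearMap.id)}

/-- The underlying matrix of an element of a subgroup of `GL_n(k)`. -/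
def matOf {n : ℕ} {Wt : Subgroup (Matrix.GeneralLinearGroup (Fin n) k)} (w : ↥Wt) :
    Matrix (Fin n) (Fin n) k :=
  ((w : Matrix.GeneralLinearGroup (Fin n) k) : Matrix (Fin n) (Fin n) k)

section Averaging

variable {R Γ : Type} [CommRing R] [Algebra k R] [Group Γ]

/-- The subalgebra of fixed points of a group of algebra endomorphisms. -/
def fixedAlg (ρ : Γ →* (R →ₐ[k] R)) : Subalgebra k R where
  carrier := {f | ∀ γ, ρ γ f = f}
  mul_mem' := fun {a b} ha hb γ => by rw [map_mul, ha γ, hb γ]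
  add_mem' := fun {a b} ha hb γ => by rw [map_add, ha γ, hb γ]
  algebraMap_mem' := fun r γ => (ρ γ).commutes r

lemma act_mul (ρ : Γ →* (R →ₐ[k] R)) (a b : Γ) (f : R) : ρ (a * b) f = ρ a (ρ b f) := by
  rw [map_mul]; rfl

lemma act_one (ρ : Γ →* (R →ₐ[k] R)) (f : R) : ρ 1 f = f := by rw [map_one]; rfl

lemma act_inv_self (ρ : Γ →* (R →ₐ[k] R)) (a : Γ) (f : R) : ρ a⁻¹ (ρ a f) = f := by
  rw [← act_mul, inv_mul_cancel, act_one]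

/-- If every element of a generating set moves `f` by an element of a stable ideal, then so does
every group element. -/
lemma act_sub_mem_of_closure (ρ : Γ →* (R →ₐ[k] R)) {J : Ideal R}
    (hJ : ∀ γ, ∀ f ∈ J, ρ γ f ∈ J) {T : Set Γ} (hT : Subgroup.closure T = ⊤) {f : R}
    (h : ∀ s ∈ T, ρ s f - f ∈ J) (γ : Γ) : ρ γ f - f ∈ J := by
  have hγ : γ ∈ Subgroup.closure T := hT ▸ Subgroup.mem_top γ
  induction hγ using Subgroup.closure_induction with
  | mem s hs => exact h s hs
  | one => simp
  | mul a b _ _ ha hb =>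
    have := J.add_mem (hJ a _ hb) ha
    rwa [map_sub, ← act_mul, sub_add_sub_cancel] at this
  | inv a _ ha =>
    have := J.neg_mem (hJ a⁻¹ _ ha)
    rwa [map_sub, act_inv_self, neg_sub] at this

variable [Fintype Γ]

/-- The averaging (Reynolds) operator of a finite group of algebra endomorphisms. -/
def avg (ρ : Γ →* (R →ₐ[k] R)) : R →ₗ[k] R :=
  (Fintype.card Γ : k)⁻¹ • ∑ γ, (ρ γ).toLinearMap

lemma avg_apply (ρ : Γ →* (R →ₐ[k] R)) (f : R) :
    avg ρ f = (Fintype.card Γ : k)⁻¹ • ∑ γ, ρ γ f := by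
  simp [avg]

lemma act_sum_act (ρ : Γ →* (R →ₐ[k] R)) (γ : Γ) (f : R) :
    ρ γ (∑ δ, ρ δ f) = ∑ δ, ρ δ f := by
  rw [map_sum]
  simp_rw [← act_mul]
  exact Fintype.sum_equiv (Equiv.mulLeft γ) _ _ fun _ => rfl

lemma avg_mem (ρ : Γ →* (R →ₐ[k] R)) (f : R) : avg ρ f ∈ fixedAlg ρ := by
  intro γ
  rw [avg_apply, map_smul, act_sum_act]

lemma avg_mul (ρ : Γ →* (R →ₐ[k] R)) (a : R) {b : R} (hb : b ∈ fixedAlg ρ) :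
    avg ρ (a * b) = avg ρ a * b := by
  rw [avg_apply, avg_apply, smul_mul_assoc, Finset.sum_mul]
  simp_rw [map_mul, hb _]

lemma avg_act (ρ : Γ →* (R →ₐ[k] R)) (γ : Γ) (f : R) : avg ρ (ρ γ f) = avg ρ f := by
  rw [avg_apply, avg_apply]
  simp_rw [← act_mul]
  congr 1
  exact Fintype.sum_equiv (Equiv.mulRight γ) _ _ fun _ => rfl

lemma avg_mem_submodule (ρ : Γ →* (R →ₐ[k] R)) {P : Submodule k R} {f : R}
    (h : ∀ γ, ρ γ f ∈ P) : avg ρ f ∈ P := by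
  rw [avg_apply]
  exact P.smul_mem _ (P.sum_mem fun γ _ => h γ)

variable [CharZero k]

lemma avg_of_mem (ρ : Γ →* (R →ₐ[k] R)) {f : R} (hf : f ∈ fixedAlg ρ) : avg ρ f = f := by
  rw [avg_apply]
  simp_rw [hf _]
  rw [Finset.sum_const, Finset.card_univ, ← Nat.cast_smul_eq_nsmul k, inv_smul_smul₀]
  exact_mod_cast Fintype.card_ne_zero

lemma avg_sub_mem (ρ : Γ →* (R →ₐ[k] R)) {J : Ideal R} {f : R} (h : ∀ γ, ρ γ f - f ∈ J) :
    avg ρ f - f ∈ J := by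
  have h1 : avg ρ f - f = (Fintype.card Γ : k)⁻¹ • ∑ γ, (ρ γ f - f) := by
    rw [Finset.sum_sub_distrib, smul_sub, ← avg_apply, Finset.sum_const, Finset.card_univ,
      ← Nat.cast_smul_eq_nsmul k, inv_smul_smul₀]
    exact_mod_cast Fintype.card_ne_zero
  rw [h1]
  exact (J.restrictScalars k).smul_mem _ (J.sum_mem fun γ _ => h γ)

end Averaging

section Chevalley

variable {σ Γ ι : Type} [Group Γ]

/-- The ideal generated by the invariants without constant term. -/
def hilbertIdeal (ρ : Γ →* (MvPolynomial σ k →ₐ[k] MvPolynomial σ k)) :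
    Ideal (MvPolynomial σ k) :=
  Ideal.span {f | f ∈ fixedAlg ρ ∧ constantCoeff f = 0}

/-- An algebra endomorphism `s` of a polynomial ring that behaves like a reflection: all
`s f - f` are divisible by a common nonzero element, and the quotient has smaller degree. -/
def IsPseudoReflection (s : MvPolynomial σ k →ₐ[k] MvPolynomial σ k) : Prop :=
  ∃ ℓ : MvPolynomial σ k, ℓ ≠ 0 ∧ ∀ f, ∃ g, s f - f = ℓ * g ∧
    (g = 0 ∨ g.totalDegree < f.totalDegree)

lemma hilbertIdeal_stable (ρ : Γ →* (MvPolynomial σ k →ₐ[k] MvPolynomial σ k)) (γ : Γ) :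
    ∀ f ∈ hilbertIdeal ρ, ρ γ f ∈ hilbertIdeal ρ := by
  intro f hf
  have : hilbertIdeal ρ ≤ (hilbertIdeal ρ).comap (ρ γ) := by
    refine Ideal.span_le.2 fun g hg => ?_
    change ρ γ g ∈ hilbertIdeal ρ
    rw [hg.1 γ]
    exact Ideal.subset_span hg
  exact this hf

variable [CharZero k]

/-- Chevalley's lemma on relations between invariants. -/
lemma coeff_mem_hilbertIdeal [Fintype Γ] (ρ : Γ →* (MvPolynomial σ k →ₐ[k] MvPolynomial σ k))
    {T : Set Γ} (hT : Subgroup.closure T = ⊤) (hrefl : ∀ s ∈ T, IsPseudoReflection (ρ s))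
    [DecidableEq ι] (Q : Finset ι) (f : ι → MvPolynomial σ k) (hf : ∀ i, f i ∈ fixedAlg ρ)
    (i₀ : ι) (hi₀ : i₀ ∈ Q)
    (hmin : ∀ (u : MvPolynomial σ k) (v : ι → MvPolynomial σ k), u ∈ fixedAlg ρ →
      (∀ i, v i ∈ fixedAlg ρ) → u * f i₀ = ∑ i ∈ Q.erase i₀, v i * f i → constantCoeff u = 0)
    (g : ι → MvPolynomial σ k) (hg : ∑ i ∈ Q, g i * f i = 0) :
    g i₀ ∈ hilbertIdeal ρ := by
  induction hN : (g i₀).totalDegree using Nat.strong_induction_on generalizing g with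
  | _ N ih =>
    have hT' : ∀ s ∈ T, ρ s (g i₀) - g i₀ ∈ hilbertIdeal ρ := by
      intro s hs
      obtain ⟨ℓ, hℓ, h⟩ := hrefl s hs
      choose Δ hΔ hdeg using h
      have hrel : ∑ i ∈ Q, Δ (g i) * f i = 0 := by
        refine (mul_eq_zero.1 ?_).resolve_left hℓ
        calc ℓ * ∑ i ∈ Q, Δ (g i) * f i = ∑ i ∈ Q, (ρ s (g i * f i) - g i * f i) := by
              rw [Finset.mul_sum]
              refine Finset.sum_congr rfl fun i _ => ?_
              rw [map_mul, hf i s, ← sub_mul, hΔ, mul_assoc]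
          _ = 0 := by rw [Finset.sum_sub_distrib, ← map_sum, hg, map_zero, sub_zero]
      rw [hΔ]
      refine Ideal.mul_mem_left _ _ ?_
      rcases hdeg (g i₀) with h0 | hlt
      · rw [h0]; exact Ideal.zero_mem _
      · exact ih _ (hN ▸ hlt) (fun i => Δ (g i)) hrel rfl
    have hmem := avg_sub_mem ρ (act_sub_mem_of_closure ρ (hilbertIdeal_stable ρ) hT hT')
    have havg : ∑ i ∈ Q, avg ρ (g i) * f i = 0 := by
      have := congrArg (avg ρ) hg
      rw [map_sum, map_zero] at this
      rw [← this]
      exact Finset.sum_congr rfl fun i _ => (avg_mul ρ _ (hf i)).symm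
    have h0 : constantCoeff (avg ρ (g i₀)) = 0 := by
      refine hmin _ (fun i => -avg ρ (g i)) (avg_mem ρ _) (fun i => neg_mem (avg_mem ρ _)) ?_
      rw [← Finset.add_sum_erase Q _ hi₀] at havg
      simp_rw [neg_mul, Finset.sum_neg_distrib]
      exact eq_neg_of_add_eq_zero_left havg
    have h1 : avg ρ (g i₀) ∈ hilbertIdeal ρ := Ideal.subset_span ⟨avg_mem ρ _, h0⟩
    simpa using Ideal.sub_mem _ h1 hmem

omit [CharZero k] in
lemma derivation_aeval [Fintype ι] (D : Derivation k (MvPolynomial σ k) (MvPolynomial σ k))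
    (f : ι → MvPolynomial σ k) (P : MvPolynomial ι k) :
    D (aeval f P) = ∑ i, aeval f (pderiv i P) * D (f i) := by
  classical
  induction P using MvPolynomial.induction_on with
  | C a => simp
  | add p q hp hq => simp only [map_add, hp, hq, add_mul, Finset.sum_add_distrib]
  | mul_X p j hp =>
    have : ∀ i, aeval f (pderiv i (p * X j)) * D (f i)
        = f j * (aeval f (pderiv i p) * D (f i)) + (if i = j then aeval f p * D (f j) else 0) := by
      intro i
      rcases eq_or_ne i j with rfl | h
      · simp; ring
      · rw [pderiv_mul, pderiv_X_of_ne h.symm, if_neg h]; simp; ring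
    simp_rw [this, Finset.sum_add_distrib, ← Finset.mul_sum, ← hp]
    simp; ring

lemma exists_pderiv_ne_zero (P : MvPolynomial ι k) (hP : P.totalDegree ≠ 0) :
    ∃ i, pderiv i P ≠ 0 := by
  classical
  by_contra! h
  refine hP ?_
  rw [totalDegree_eq_zero_iff]
  intro m hm i
  by_contra hi
  have h1 := congrArg (coeff (m - Finsupp.single i 1)) (h i)
  rw [coeff_pderiv, coeff_zero] at h1
  have h2 : m - Finsupp.single i 1 + Finsupp.single i 1 = m := by
    refine tsub_add_cancel_of_le ?_
    rw [Finsupp.single_le_iff]; omega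
  rw [h2] at h1
  rcases mul_eq_zero.1 h1 with h3 | h3
  · exact (mem_support_iff.1 hm) h3
  · exact Nat.cast_add_one_ne_zero _ h3

omit [CharZero k] in
lemma totalDegree_pderiv_lt (P : MvPolynomial ι k) (i : ι) (hP : P.totalDegree ≠ 0) :
    (pderiv i P).totalDegree < P.totalDegree := by
  classical
  rw [totalDegree, Finset.sup_lt_iff (Nat.pos_of_ne_zero hP)]
  intro m hm
  rw [mem_support_iff, coeff_pderiv] at hm
  have h := le_totalDegree (mem_support_iff.2 (left_ne_zero_of_mul hm))
  rw [Finsupp.sum_add_index' (by simp) (by simp)] at h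
  simp at h
  simpa [Finsupp.sum] using h

end Chevalley

section Independence

variable {σ Γ ι : Type} [Fintype σ] [Group Γ] [Fintype Γ] [CharZero k]

/-- `u • P i` is a combination of the `P j`, `j ∈ Q`, with invariant coefficients, for some
invariant `u` with nonzero constant term. -/
def LocSpanned (ρ : Γ →* (MvPolynomial σ k →ₐ[k] MvPolynomial σ k))
    (P : ι → MvPolynomial σ k) (Q : Finset ι) (i : ι) : Prop :=
  ∃ u ∈ fixedAlg ρ, constantCoeff u ≠ 0 ∧ ∃ v : ι → MvPolynomial σ k,
    (∀ j, v j ∈ fixedAlg ρ) ∧ u * P i = ∑ j ∈ Q, v j * P j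

omit [Fintype σ] [Fintype Γ] [CharZero k] in
lemma exists_minimal_locSpanned [Fintype ι] [DecidableEq ι]
    (ρ : Γ →* (MvPolynomial σ k →ₐ[k] MvPolynomial σ k)) (P : ι → MvPolynomial σ k) :
    ∃ Q : Finset ι, (∀ i, LocSpanned ρ P Q i) ∧
      ∀ i₀ ∈ Q, ∀ (u : MvPolynomial σ k) (v : ι → MvPolynomial σ k), u ∈ fixedAlg ρ →
      (∀ i, v i ∈ fixedAlg ρ) → u * P i₀ = ∑ i ∈ Q.erase i₀, v i * P i →
      constantCoeff u = 0 := by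
  obtain ⟨Q, hQ⟩ := exists_minimal_of_wellFoundedLT
    (fun Q : Finset ι => ∀ i, LocSpanned ρ P Q i)
    ⟨Finset.univ, fun i => ⟨1, one_mem _, by simp, Pi.single i 1, fun j => by
      rcases eq_or_ne j i with rfl | h
      · simp
      · simp [h], by simp [Pi.single_apply]⟩⟩
  refine ⟨Q, hQ.prop, fun i₀ hi₀ u v hu hv h => ?_⟩
  by_contra hu0
  have hlt : Q.erase i₀ < Q := Finset.erase_ssubset hi₀
  refine hQ.not_prop_of_lt hlt fun i => ?_
  obtain ⟨u', hu', hu'0, v', hv', h'⟩ := hQ.prop i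
  refine ⟨u * u', mul_mem hu hu', by simp [hu0, hu'0], fun j => u * v' j + v' i₀ * v j,
    fun j => add_mem (mul_mem hu (hv' j)) (mul_mem (hv' i₀) (hv j)), ?_⟩
  rw [mul_assoc, h', ← Finset.add_sum_erase Q _ hi₀, mul_add, mul_left_comm, h, Finset.mul_sum,
    Finset.mul_sum, ← Finset.sum_add_distrib]
  exact Finset.sum_congr rfl fun j _ => by ring

/-- Chevalley's independence theorem: homogeneous invariants which minimally generate the
Hilbert ideal of a reflection group are algebraically independent. -/
theorem algebraicIndependent_of_minimal [Fintype ι] [DecidableEq ι]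
    (ρ : Γ →* (MvPolynomial σ k →ₐ[k] MvPolynomial σ k))
    {T : Set Γ} (hT : Subgroup.closure T = ⊤) (hrefl : ∀ s ∈ T, IsPseudoReflection (ρ s))
    (w : σ → ℕ) (f : ι → MvPolynomial σ k) (e : ι → ℕ)
    (hf : ∀ i, f i ∈ fixedAlg ρ) (hhom : ∀ i, IsWeightedHomogeneous w (f i) (e i))
    (he : ∀ i, e i ≠ 0)
    (hgen : ∀ h ∈ hilbertIdeal ρ, ∃ q, constantCoeff q ≠ 0 ∧
      ∃ a : ι → MvPolynomial σ k, q * h = ∑ i, a i * f i)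
    (hmin : ∀ i (a : ι → MvPolynomial σ k), ∑ j, a j * f j = 0 → constantCoeff (a i) = 0) :
    AlgebraicIndependent k f := by
  rw [algebraicIndependent_iff]
  by_contra! hcon
  obtain ⟨P₀, hP₀⟩ := hcon
  obtain ⟨P, ⟨hPf, hP0⟩, hPmin⟩ := exists_minimalFor_of_wellFoundedLT
    (fun P : MvPolynomial ι k => aeval f P = 0 ∧ P ≠ 0) totalDegree ⟨P₀, hP₀⟩
  have hdeg : P.totalDegree ≠ 0 := by
    intro h
    rw [totalDegree_eq_zero_iff_eq_C] at h
    rw [h, aeval_C] at hPf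
    refine hP0 ?_
    rw [h, (map_eq_zero _).1 hPf, C_0]
  obtain ⟨i₁, hi₁⟩ := exists_pderiv_ne_zero P hdeg
  set p : ι → MvPolynomial σ k := fun i => aeval f (pderiv i P) with hp
  have hp1 : p i₁ ≠ 0 := fun h =>
    absurd (hPmin ⟨h, hi₁⟩ (totalDegree_pderiv_lt P i₁ hdeg).le)
      (not_le.2 (totalDegree_pderiv_lt P i₁ hdeg))
  have hpinv : ∀ i, p i ∈ fixedAlg ρ := by
    intro i
    have : p i ∈ (aeval f).range := ⟨_, rfl⟩
    rw [← Algebra.adjoin_range_eq_range_aeval] at this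
    exact Algebra.adjoin_le (by rintro _ ⟨j, rfl⟩; exact hf j) this
  obtain ⟨Q, hQ, hQmin⟩ := exists_minimal_locSpanned ρ p
  choose u hu hu0 v hv huv using hQ
  have hQne : Q.Nonempty := by
    rw [Finset.nonempty_iff_ne_empty]
    rintro rfl
    have := huv i₁
    rw [Finset.sum_empty] at this
    rcases mul_eq_zero.1 this with h | h
    · exact hu0 i₁ (by rw [h, map_zero])
    · exact hp1 h
  obtain ⟨i₀, hi₀⟩ := hQne
  set U := ∏ i, u i with hU
  have hU0 : constantCoeff U ≠ 0 := by
    rw [hU, map_prod]; exact Finset.prod_ne_zero_iff.2 fun i _ => hu0 i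
  have hV : ∀ i, ∃ V : ι → MvPolynomial σ k, U * p i = ∑ j ∈ Q, V j * p j ∧
      (i = i₀ → V i₀ = U) := by
    intro i
    by_cases hi : i = i₀
    · subst hi
      exact ⟨Pi.single i U, by simp [Pi.single_apply, hi₀], fun _ => by simp⟩
    · refine ⟨fun j => (∏ i' ∈ Finset.univ.erase i, u i') * v i j, ?_, fun h => absurd h hi⟩
      rw [hU, ← Finset.mul_prod_erase _ _ (Finset.mem_univ i), mul_comm (u i), mul_assoc, huv,
        Finset.mul_sum]
      exact Finset.sum_congr rfl fun j _ => (mul_assoc _ _ _).symm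
  choose V hV hVU using hV
  have hder : ∀ x : σ, ∑ i, V i i₀ * pderiv x (f i) ∈ hilbertIdeal ρ := by
    intro x
    refine coeff_mem_hilbertIdeal ρ hT hrefl Q p hpinv i₀ hi₀ (hQmin i₀ hi₀)
      (fun j => ∑ i, V i j * pderiv x (f i)) ?_
    have h1 : ∑ i, p i * pderiv x (f i) = 0 := by
      rw [← derivation_aeval, hPf, map_zero]
    calc ∑ j ∈ Q, (∑ i, V i j * pderiv x (f i)) * p j
        = ∑ i, (∑ j ∈ Q, V i j * p j) * pderiv x (f i) := by
          simp_rw [Finset.sum_mul]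
          rw [Finset.sum_comm]
          refine Finset.sum_congr rfl fun i _ => Finset.sum_congr rfl fun j _ => by ring
      _ = U * ∑ i, p i * pderiv x (f i) := by
          rw [Finset.mul_sum]
          refine Finset.sum_congr rfl fun i _ => by rw [← hV]; ring
      _ = 0 := by rw [h1, mul_zero]
  choose q hq0 a ha using fun x => hgen _ (hder x)
  set q' := ∏ x, q x with hq'
  have hq'0 : constantCoeff q' ≠ 0 := by
    rw [hq', map_prod]; exact Finset.prod_ne_zero_iff.2 fun i _ => hq0 i
  classical
  set b : σ → ι → MvPolynomial σ k := fun x i => (∏ y ∈ Finset.univ.erase x, q y) * a x i with hb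
  have hb' : ∀ x, q' * ∑ i, V i i₀ * pderiv x (f i) = ∑ i, b x i * f i := by
    intro x
    rw [hq', ← Finset.mul_prod_erase _ _ (Finset.mem_univ x), mul_comm (q x), mul_assoc, ha,
      Finset.mul_sum]
    exact Finset.sum_congr rfl fun i _ => (mul_assoc _ _ _).symm
  have heuler : ∑ i, q' * V i i₀ * (e i : MvPolynomial σ k) * f i
      = ∑ i, (∑ x, (w x : MvPolynomial σ k) * X x * b x i) * f i := by
    calc ∑ i, q' * V i i₀ * (e i : MvPolynomial σ k) * f i
        = ∑ i, q' * V i i₀ * ∑ x, w x • (X x * pderiv x (f i)) := by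
          refine Finset.sum_congr rfl fun i _ => ?_
          rw [(hhom i).sum_weight_X_mul_pderiv, nsmul_eq_mul]; ring
      _ = ∑ x, (w x : MvPolynomial σ k) * X x * (q' * ∑ i, V i i₀ * pderiv x (f i)) := by
          simp_rw [Finset.mul_sum]
          rw [Finset.sum_comm]
          refine Finset.sum_congr rfl fun x _ => Finset.sum_congr rfl fun i _ => ?_
          rw [nsmul_eq_mul]; ring
      _ = _ := by
          simp_rw [hb', Finset.mul_sum, Finset.sum_mul]
          rw [Finset.sum_comm]
          refine Finset.sum_congr rfl fun x _ => Finset.sum_congr rfl fun i _ => by ring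
  have hfin := hmin i₀ (fun i => q' * V i i₀ * (e i : MvPolynomial σ k)
      - ∑ x, (w x : MvPolynomial σ k) * X x * b x i) (by
    simp_rw [sub_mul]
    rw [Finset.sum_sub_distrib, heuler, sub_self])
  rw [hVU i₀ rfl] at hfin
  simp only [map_sub, map_mul, map_sum, constantCoeff_X, mul_zero, zero_mul,
    Finset.sum_const_zero, sub_zero, map_natCast] at hfin
  exact mul_ne_zero (mul_ne_zero hq'0 hU0) (Nat.cast_ne_zero.2 (he i₀)) hfin

end Independence

section Generators

variable {σ Γ ι : Type}

attribute [local instance] MvPolynomial.weightedGradedAlgebra in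
lemma weightedHomogeneousComponent_mul_right (w : σ → ℕ) (h : MvPolynomial σ k)
    {f : MvPolynomial σ k} {e : ℕ} (hf : IsWeightedHomogeneous w f e) (D : ℕ) :
    weightedHomogeneousComponent w D (h * f) =
      if e ≤ D then weightedHomogeneousComponent w (D - e) h * f else 0 := by
  have := DirectSum.coe_decompose_mul_of_right_mem (weightedHomogeneousSubmodule k w) D
    (a := h) (b := f) (i := e) hf
  simp_rw [← weightedDecomposition.decompose'_apply]
  exact this

/-- The group action preserves the weighted degree. -/
def PreservesWeight [Group Γ] (ρ : Γ →* (MvPolynomial σ k →ₐ[k] MvPolynomial σ k)) (w : σ → ℕ) :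
    Prop :=
  ∀ γ f D, IsWeightedHomogeneous w f D → IsWeightedHomogeneous w (ρ γ f) D

lemma constantCoeff_eq_zero_of_homogeneous {w : σ → ℕ} {f : MvPolynomial σ k} {D : ℕ}
    (hf : IsWeightedHomogeneous w f D) (hD : D ≠ 0) : constantCoeff f = 0 := by
  rw [constantCoeff_eq]
  exact hf.coeff_eq_zero 0 (by simpa using hD.symm)

variable [Group Γ] [Fintype Γ]

lemma avg_homogeneous {ρ : Γ →* (MvPolynomial σ k →ₐ[k] MvPolynomial σ k)} {w : σ → ℕ}
    (hρ : PreservesWeight ρ w) {f : MvPolynomial σ k} {D : ℕ}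
    (hf : IsWeightedHomogeneous w f D) : IsWeightedHomogeneous w (avg ρ f) D :=
  avg_mem_submodule ρ (P := weightedHomogeneousSubmodule k w D) fun γ => hρ γ f D hf

variable [CharZero k]

/-- Every invariant is a sum of homogeneous invariants. -/
lemma exists_sum_homogeneous {ρ : Γ →* (MvPolynomial σ k →ₐ[k] MvPolynomial σ k)} {w : σ → ℕ}
    (hρ : PreservesWeight ρ w) {f : MvPolynomial σ k} (hf : f ∈ fixedAlg ρ) :
    ∃ (S : Finset ℕ) (u : ℕ → MvPolynomial σ k), (∀ D, u D ∈ fixedAlg ρ) ∧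
      (∀ D, IsWeightedHomogeneous w (u D) D) ∧ f = ∑ D ∈ S, u D := by
  have hfin := weightedHomogeneousComponent_finsupp (w := w) f
  refine ⟨hfin.toFinset, fun D => avg ρ (weightedHomogeneousComponent w D f),
    fun D => avg_mem ρ _, fun D => avg_homogeneous hρ
      (weightedHomogeneousComponent_mem w f D), ?_⟩
  rw [← map_sum]
  have := finsum_weightedHomogeneousComponent (w := w) f
  rw [finsum_eq_sum _ hfin] at this
  rw [this, avg_of_mem ρ hf]

/-- Homogeneous invariants which generate the Hilbert ideal (up to a function not vanishing at the
origin) generate the algebra of invariants. -/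
lemma fixedAlg_eq_adjoin [Fintype ι] {ρ : Γ →* (MvPolynomial σ k →ₐ[k] MvPolynomial σ k)}
    {w : σ → ℕ} (hw : ∀ i, w i ≠ 0) (hρ : PreservesWeight ρ w)
    (f : ι → MvPolynomial σ k) (e : ι → ℕ)
    (hf : ∀ i, f i ∈ fixedAlg ρ) (hhom : ∀ i, IsWeightedHomogeneous w (f i) (e i))
    (he : ∀ i, e i ≠ 0)
    (hgen : ∀ h ∈ hilbertIdeal ρ, ∃ q, constantCoeff q ≠ 0 ∧
      ∃ a : ι → MvPolynomial σ k, q * h = ∑ i, a i * f i) :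
    Algebra.adjoin k (Set.range f) = fixedAlg ρ := by
  refine le_antisymm (Algebra.adjoin_le (by rintro _ ⟨j, rfl⟩; exact hf j)) fun u hu => ?_
  suffices h : ∀ D u, u ∈ fixedAlg ρ → IsWeightedHomogeneous w u D →
      u ∈ Algebra.adjoin k (Set.range f) by
    obtain ⟨S, v, hv, hvh, rfl⟩ := exists_sum_homogeneous hρ hu
    exact sum_mem fun D _ => h D _ (hv D) (hvh D)
  clear hu u
  intro D
  induction D using Nat.strong_induction_on with
  | _ D ih =>
    intro u hu huD
    have hz : ∀ φ : MvPolynomial σ k, weightedHomogeneousComponent w 0 φ = C (coeff 0 φ) :=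
      fun φ => weightedHomogeneousComponent_zero φ hw
    rcases eq_or_ne D 0 with rfl | hD
    · have h1 := huD.weightedHomogeneousComponent_same
      rw [hz] at h1
      rw [← h1]
      exact Subalgebra.algebraMap_mem _ _
    · obtain ⟨q, hq, a, ha⟩ := hgen u
        (Ideal.subset_span ⟨hu, constantCoeff_eq_zero_of_homogeneous huD hD⟩)
      have h1 := congrArg (weightedHomogeneousComponent w D) ha
      rw [weightedHomogeneousComponent_mul_right w q huD, if_pos le_rfl, Nat.sub_self, hz,
        map_sum] at h1
      simp_rw [weightedHomogeneousComponent_mul_right w _ (hhom _)] at h1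
      have h2 := congrArg (avg ρ) h1
      rw [avg_mul ρ _ hu, map_sum, avg_of_mem ρ (f := C (coeff 0 q)) (Subalgebra.algebraMap_mem _ _)] at h2
      have h3 : C (coeff 0 q) * u ∈ Algebra.adjoin k (Set.range f) := by
        rw [h2]
        refine sum_mem fun i _ => ?_
        split_ifs with hi
        · rw [avg_mul ρ _ (hf i)]
          refine mul_mem (ih (D - e i) ?_ _ (avg_mem ρ _) (avg_homogeneous hρ
            (weightedHomogeneousComponent_mem w _ _)))
            (Algebra.subset_adjoin ⟨i, rfl⟩)
          have := he i
          omega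
        · rw [map_zero]; exact zero_mem _
      rw [← smul_eq_C_mul] at h3
      rw [← inv_smul_smul₀ (a := coeff 0 q) hq u]
      exact Subalgebra.smul_mem _ h3 _

omit [Fintype Γ] [CharZero k] in
lemma hilbertIdeal_eq_span {ρ : Γ →* (MvPolynomial σ k →ₐ[k] MvPolynomial σ k)}
    (F : Set (MvPolynomial σ k)) (hF : Algebra.adjoin k F = fixedAlg ρ)
    (h0 : ∀ f ∈ F, constantCoeff f = 0) : hilbertIdeal ρ = Ideal.span F := by
  refine le_antisymm (Ideal.span_le.2 ?_) (Ideal.span_mono fun f hf =>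
    ⟨hF ▸ Algebra.subset_adjoin hf, h0 f hf⟩)
  rintro u ⟨hu, hu0⟩
  rw [← hF] at hu
  suffices h : u - C (constantCoeff u) ∈ Ideal.span F by simpa [hu0] using h
  clear hu0
  induction hu using Algebra.adjoin_induction with
  | mem x hx => rw [h0 x hx, C_0, sub_zero]; exact Ideal.subset_span hx
  | algebraMap r => simp [algebraMap_eq]
  | add x y _ _ hx hy =>
    have := add_mem hx hy
    rw [map_add, C_add]
    convert this using 1
    ring
  | mul x y _ _ hx hy =>
    have := add_mem (Ideal.mul_mem_left _ y hx) (Ideal.mul_mem_left _ (C (constantCoeff x)) hy)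
    rw [map_mul, C_mul]
    convert this using 1
    ring

variable [Fintype σ]

/-- A version of the theorem of Chevalley, Shephard and Todd: any finite family of homogeneous
generators of the invariant algebra of a reflection group contains an algebraically independent
generating subfamily. -/
theorem exists_basic_subfamily [Fintype ι] [DecidableEq ι]
    {ρ : Γ →* (MvPolynomial σ k →ₐ[k] MvPolynomial σ k)}
    {T : Set Γ} (hT : Subgroup.closure T = ⊤) (hrefl : ∀ s ∈ T, IsPseudoReflection (ρ s))
    {w : σ → ℕ} (hw : ∀ i, w i ≠ 0) (hρ : PreservesWeight ρ w)
    (f : ι → MvPolynomial σ k) (e : ι → ℕ)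
    (hhom : ∀ i, IsWeightedHomogeneous w (f i) (e i)) (he : ∀ i, e i ≠ 0)
    (hgen : Algebra.adjoin k (Set.range f) = fixedAlg ρ) :
    ∃ S : Finset ι, AlgebraicIndependent k (fun i : S => f i) ∧
      Algebra.adjoin k (Set.range fun i : S => f i) = fixedAlg ρ := by
  have hf : ∀ i, f i ∈ fixedAlg ρ := fun i => hgen ▸ Algebra.subset_adjoin ⟨i, rfl⟩
  have hspan := hilbertIdeal_eq_span (Set.range f) hgen (by
    rintro _ ⟨i, rfl⟩; exact constantCoeff_eq_zero_of_homogeneous (hhom i) (he i))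
  obtain ⟨S, hS⟩ := exists_minimal_of_wellFoundedLT
    (fun S : Finset ι => ∀ h ∈ hilbertIdeal ρ, ∃ q, constantCoeff q ≠ 0 ∧
      ∃ a : ι → MvPolynomial σ k, q * h = ∑ i ∈ S, a i * f i)
    ⟨Finset.univ, fun h hh => by
      rw [hspan, Ideal.mem_span_range_iff_exists_fun] at hh
      obtain ⟨a, ha⟩ := hh
      exact ⟨1, by simp, a, by rw [one_mul, ha]⟩⟩
  have hgen' : ∀ h ∈ hilbertIdeal ρ, ∃ q, constantCoeff q ≠ 0 ∧
      ∃ a : S → MvPolynomial σ k, q * h = ∑ i, a i * f i := by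
    intro h hh
    obtain ⟨q, hq, a, ha⟩ := hS.prop h hh
    exact ⟨q, hq, fun i => a i, by rw [ha, ← Finset.sum_coe_sort S]⟩
  refine ⟨S, algebraicIndependent_of_minimal ρ hT hrefl w (fun i : S => f i) (fun i => e i)
    (fun i => hf i) (fun i => hhom i) (fun i => he i) hgen' ?_,
    fixedAlg_eq_adjoin hw hρ (fun i : S => f i) (fun i => e i)
    (fun i => hf i) (fun i => hhom i) (fun i => he i) hgen'⟩
  rintro ⟨i, hi⟩ a ha
  by_contra hai
  refine hS.not_prop_of_lt (Finset.erase_ssubset hi) fun h hh => ?_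
  obtain ⟨q, hq, b, hb⟩ := hS.prop h hh
  set a' : ι → MvPolynomial σ k := fun j => if hj : j ∈ S then a ⟨j, hj⟩ else 0 with ha'
  have h1 : ∑ j ∈ S, a' j * f j = 0 := by
    rw [← ha, ← Finset.sum_coe_sort S]
    exact Finset.sum_congr rfl fun j _ => by simp [ha']
  have h2 : a' i = a ⟨i, hi⟩ := by simp [ha', hi]
  refine ⟨a' i * q, by rw [map_mul, h2]; exact mul_ne_zero hai hq,
    fun j => a' i * b j - b i * a' j, ?_⟩
  rw [← Finset.add_sum_erase S _ hi] at h1 hb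
  rw [mul_assoc, hb]
  simp_rw [sub_mul, Finset.sum_sub_distrib, mul_assoc, ← Finset.mul_sum]
  linear_combination b i * h1

/-- The invariant algebra has a finite family of homogeneous generators. -/
lemma exists_homogeneous_generators
    {ρ : Γ →* (MvPolynomial σ k →ₐ[k] MvPolynomial σ k)}
    {w : σ → ℕ} (hw : ∀ i, w i ≠ 0) (hρ : PreservesWeight ρ w) :
    ∃ (N : ℕ) (f : Fin N → MvPolynomial σ k) (e : Fin N → ℕ),
      (∀ i, IsWeightedHomogeneous w (f i) (e i)) ∧ (∀ i, e i ≠ 0) ∧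
      Algebra.adjoin k (Set.range f) = fixedAlg ρ := by
  set Y : Set (MvPolynomial σ k) :=
    {f | f ∈ fixedAlg ρ ∧ ∃ D, D ≠ 0 ∧ IsWeightedHomogeneous w f D} with hY
  have h1 : hilbertIdeal ρ = Ideal.span Y := by
    refine le_antisymm (Ideal.span_le.2 ?_) (Ideal.span_mono ?_)
    · rintro u ⟨hu, hu0⟩
      obtain ⟨S, v, hv, hvh, rfl⟩ := exists_sum_homogeneous hρ hu
      have hv0 : ∀ D, D ≠ 0 → constantCoeff (v D) = 0 := fun D hD =>
        constantCoeff_eq_zero_of_homogeneous (hvh D) hD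
      have hz : v 0 = C (constantCoeff (v 0)) := by
        conv_lhs => rw [← (hvh 0).weightedHomogeneousComponent_same,
          weightedHomogeneousComponent_zero _ hw]
        rfl
      refine sum_mem fun D hD => ?_
      rcases eq_or_ne D 0 with rfl | hD0
      · rw [map_sum, Finset.sum_eq_single_of_mem 0 hD fun D _ h => hv0 D h] at hu0
        rw [hz, hu0, C_0]
        exact zero_mem _
      · exact Ideal.subset_span ⟨hv D, D, hD0, hvh D⟩
    · rintro u ⟨hu, D, hD, huD⟩
      exact ⟨hu, constantCoeff_eq_zero_of_homogeneous huD hD⟩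
  have h2 : (Submodule.span (MvPolynomial σ k) Y).FG :=
    IsNoetherian.noetherian (Ideal.span Y)
  rw [Submodule.fg_span_iff_fg_span_finset_subset] at h2
  obtain ⟨Z, hZY, hZ⟩ := h2
  choose e he using fun i : Fin Z.card => (hZY (Z.equivFin.symm i).2).2
  set f : Fin Z.card → MvPolynomial σ k := fun i => Z.equivFin.symm i with hfdef
  have hr : Set.range f = Z := by
    ext x
    constructor
    · rintro ⟨i, rfl⟩; exact (Z.equivFin.symm i).2
    · intro hx; exact ⟨Z.equivFin ⟨x, hx⟩, by simp [hfdef]⟩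
  refine ⟨Z.card, f, e, fun i => (he i).2, fun i => (he i).1,
    fixedAlg_eq_adjoin hw hρ f e (fun i => (hZY (Z.equivFin.symm i).2).1) (fun i => (he i).2)
      (fun i => (he i).1) fun h hh => ⟨1, by simp, ?_⟩⟩
  rw [h1] at hh
  change h ∈ Submodule.span _ Y at hh
  rw [hZ, ← hr] at hh
  obtain ⟨a, ha⟩ := Ideal.mem_span_range_iff_exists_fun.1 hh
  exact ⟨a, by rw [one_mul, ha]⟩

end Generators

section LinearSubstitution

variable {σ : Type}

lemma isWeightedHomogeneous_map (ψ : MvPolynomial σ k →ₐ[k] MvPolynomial σ k) {w : σ → ℕ}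
    (hψ : ∀ i, IsWeightedHomogeneous w (ψ (X i)) (w i)) {f : MvPolynomial σ k} {D : ℕ}
    (hf : IsWeightedHomogeneous w f D) : IsWeightedHomogeneous w (ψ f) D := by
  conv => arg 2; rw [f.as_sum, map_sum]
  refine (weightedHomogeneousSubmodule k w D).sum_mem fun m hm => ?_
  have h1 : ψ (monomial m (coeff m f)) = C (coeff m f) * ∏ i ∈ m.support, ψ (X i) ^ m i := by
    rw [monomial_eq, map_mul, Finsupp.prod, map_prod]
    simp_rw [map_pow]
    congr 1
    exact ψ.commutes _
  rw [h1]
  refine IsWeightedHomogeneous.C_mul ?_ _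
  have h2 := IsWeightedHomogeneous.prod m.support (fun i => ψ (X i) ^ m i)
    (fun i => m i • w i) (w := w) fun i _ => (hψ i).pow (m i)
  have h3 := hf (mem_support_iff.1 hm)
  rw [Finsupp.weight_apply, Finsupp.sum] at h3
  rwa [h3] at h2

/-- The difference quotient of a monomial under a transvection-like substitution. -/
lemma exists_monomial_quotient (ψ : MvPolynomial σ k →ₐ[k] MvPolynomial σ k)
    {ℓ : MvPolynomial σ k} (hℓ : ℓ.IsHomogeneous 1) (b : σ → k)
    (hψ : ∀ i, ψ (X i) = X i + b i • ℓ) (N : ℕ) (m : σ →₀ ℕ) (hm : m.degree = N) :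
    ∃ g, ψ (monomial m 1) - monomial m 1 = ℓ * g ∧ (g = 0 ∨ g.IsHomogeneous (N - 1) ∧ N ≠ 0) := by
  classical
  induction N generalizing m with
  | zero =>
    rw [Finsupp.degree_eq_zero_iff] at hm
    subst hm
    refine ⟨0, ?_, Or.inl rfl⟩
    rw [show (monomial (0 : σ →₀ ℕ) (1 : k)) = 1 from rfl, map_one, sub_self, mul_zero]
  | succ N ih =>
    have hm0 : m ≠ 0 := by
      rintro rfl; simp at hm
    obtain ⟨i, hi⟩ := Finsupp.ne_iff.1 hm0
    have hle : Finsupp.single i 1 ≤ m := by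
      rw [Finsupp.single_le_iff]; exact Nat.one_le_iff_ne_zero.2 hi
    obtain ⟨m', rfl⟩ := exists_add_of_le hle
    have hm' : m'.degree = N := by
      rw [map_add, Finsupp.degree_single] at hm; omega
    obtain ⟨g, hg, hg'⟩ := ih m' hm'
    have hmon : (monomial (Finsupp.single i 1 + m') (1 : k)) = X i * monomial m' 1 := by
      rw [X, monomial_mul, one_mul]
    refine ⟨X i * g + b i • ψ (monomial m' 1), ?_, Or.inr ⟨?_, Nat.succ_ne_zero _⟩⟩
    · rw [hmon, map_mul, hψ, mul_add, mul_left_comm, ← hg, mul_smul_comm, add_mul, smul_mul_assoc]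
      ring
    · rw [Nat.add_sub_cancel]
      refine IsHomogeneous.add ?_ ?_
      · rcases hg' with rfl | ⟨hg', hN⟩
        · rw [mul_zero]; exact isHomogeneous_zero _ _ _
        · have := (isHomogeneous_X k i).mul hg'
          rwa [show 1 + (N - 1) = N by omega] at this
      · rw [smul_eq_C_mul]
        refine IsHomogeneous.C_mul ?_ _
        refine isWeightedHomogeneous_map ψ (fun j => ?_)
          (show IsWeightedHomogeneous 1 (monomial m' (1 : k)) N from
            isHomogeneous_monomial 1 hm')
        rw [hψ]
        refine IsHomogeneous.add (isHomogeneous_X k j) ?_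
        rw [smul_eq_C_mul]
        exact hℓ.C_mul _

/-- A substitution `X i ↦ X i + b i • ℓ` with `ℓ` a nonzero linear form is a pseudo-reflection. -/
lemma exists_quotient (ψ : MvPolynomial σ k →ₐ[k] MvPolynomial σ k)
    {ℓ : MvPolynomial σ k} (hℓ : ℓ.IsHomogeneous 1) (b : σ → k)
    (hψ : ∀ i, ψ (X i) = X i + b i • ℓ) (f : MvPolynomial σ k) :
    ∃ g, ψ f - f = ℓ * g ∧ (g = 0 ∨ g.totalDegree < f.totalDegree) := by
  choose g hg hg' using fun m => exists_monomial_quotient ψ hℓ b hψ _ m rfl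
  refine ⟨∑ m ∈ f.support, coeff m f • g m, ?_, ?_⟩
  · conv_lhs => rw [f.as_sum, map_sum, ← Finset.sum_sub_distrib]
    rw [Finset.mul_sum]
    refine Finset.sum_congr rfl fun m _ => ?_
    have : monomial m (coeff m f) = coeff m f • monomial m (1 : k) := by
      rw [smul_monomial, smul_eq_mul, mul_one]
    rw [this, map_smul, ← smul_sub, hg, mul_smul_comm]
  · by_cases h0 : f.totalDegree = 0
    · left
      refine Finset.sum_eq_zero fun m hm => ?_
      have h1 := le_totalDegree hm
      rw [h0] at h1
      rcases hg' m with h | ⟨_, h⟩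
      · rw [h, smul_zero]
      · exact absurd (Nat.le_zero.1 h1) h
    · right
      refine lt_of_le_of_lt (totalDegree_finsetSum _ _) ?_
      rw [Finset.sup_lt_iff (Nat.pos_of_ne_zero h0)]
      intro m hm
      refine lt_of_le_of_lt (totalDegree_smul_le _ _) ?_
      have h1 : m.degree ≤ f.totalDegree := le_totalDegree hm
      rcases hg' m with h | ⟨h, h2⟩
      · rw [h, totalDegree_zero]; exact Nat.pos_of_ne_zero h0
      · have := h.totalDegree_le
        omega

lemma isPseudoReflection_of_linear (ψ : MvPolynomial σ k →ₐ[k] MvPolynomial σ k)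
    {ℓ : MvPolynomial σ k} (hℓ : ℓ.IsHomogeneous 1) (b : σ → k)
    (hψ : ∀ i, ψ (X i) = X i + b i • ℓ) : IsPseudoReflection ψ := by
  by_cases h0 : ℓ = 0
  · refine ⟨1, one_ne_zero, fun f => ⟨0, ?_, Or.inl rfl⟩⟩
    obtain ⟨g, hg, -⟩ := exists_quotient ψ hℓ b hψ f
    rw [hg, h0, zero_mul, mul_zero]
  · exact ⟨ℓ, h0, exists_quotient ψ hℓ b hψ⟩

end LinearSubstitution

section MatrixAction

variable {n : ℕ}

lemma eval_matAct (g : Matrix.GeneralLinearGroup (Fin n) k) (x : Fin n → k)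
    (f : MvPolynomial (Fin n) k) :
    eval x (matAct g f) = eval (Matrix.mulVec (↑(g⁻¹) : Matrix (Fin n) (Fin n) k) x) f := by
  have h : (aeval x).comp (matAct g) =
      aeval (R := k) (Matrix.mulVec (↑(g⁻¹) : Matrix (Fin n) (Fin n) k) x) := by
    ext i
    simp only [AlgHom.comp_apply, matAct, aeval_X, map_sum, map_smul, smul_eq_mul]
    rfl
  exact DFunLike.congr_fun h f

lemma matAct_mul (g h : Matrix.GeneralLinearGroup (Fin n) k) :
    matAct (g * h) = (matAct g).comp (matAct h) := by
  ext i : 1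
  simp only [AlgHom.comp_apply, matAct, aeval_X, map_sum, map_smul, Finset.smul_sum, smul_smul,
    mul_inv_rev, Units.val_mul, Matrix.mul_apply, Finset.sum_smul]
  rw [Finset.sum_comm]

lemma matAct_one : matAct (1 : Matrix.GeneralLinearGroup (Fin n) k) = AlgHom.id k _ := by
  ext i : 1
  simp [matAct, Matrix.one_apply]

/-- The action of a group of matrices on polynomial functions. -/
def matRep (W : Subgroup (Matrix.GeneralLinearGroup (Fin n) k)) :
    ↥W →* (MvPolynomial (Fin n) k →ₐ[k] MvPolynomial (Fin n) k) where
  toFun w := matAct (w : Matrix.GeneralLinearGroup (Fin n) k)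
  map_one' := matAct_one
  map_mul' _ _ := matAct_mul _ _

lemma matRep_apply {W : Subgroup (Matrix.GeneralLinearGroup (Fin n) k)} (w : ↥W) :
    matRep W w = matAct (w : Matrix.GeneralLinearGroup (Fin n) k) := rfl

lemma invariants_eq_fixedAlg (G : Subgroup (Matrix.GeneralLinearGroup (Fin n) k)) :
    invariants G = fixedAlg (matRep G) := by
  ext f
  exact ⟨fun h g => h g g.2, fun h g hg => h ⟨g, hg⟩⟩

lemma matAct_inv_cancel (g : Matrix.GeneralLinearGroup (Fin n) k) (f : MvPolynomial (Fin n) k) :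
    matAct g (matAct g⁻¹ f) = f := by
  rw [← AlgHom.comp_apply, ← matAct_mul, mul_inv_cancel, matAct_one]; rfl

lemma matAct_inv_cancel' (g : Matrix.GeneralLinearGroup (Fin n) k) (f : MvPolynomial (Fin n) k) :
    matAct g⁻¹ (matAct g f) = f := by
  rw [← AlgHom.comp_apply, ← matAct_mul, inv_mul_cancel, matAct_one]; rfl

lemma matAct_isHomogeneous (g : Matrix.GeneralLinearGroup (Fin n) k)
    {f : MvPolynomial (Fin n) k} {D : ℕ} (hf : f.IsHomogeneous D) :
    (matAct g f).IsHomogeneous D := by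
  refine isWeightedHomogeneous_map (matAct g) (fun i => ?_) hf
  simp only [matAct, aeval_X]
  refine (weightedHomogeneousSubmodule k 1 1).sum_mem fun j _ => ?_
  rw [smul_eq_C_mul]
  exact IsHomogeneous.C_mul (isHomogeneous_X k j) _

lemma constantCoeff_eq_eval (f : MvPolynomial (Fin n) k) : constantCoeff f = eval 0 f := by
  simp

lemma matAct_mem_invariants {Wt G : Subgroup (Matrix.GeneralLinearGroup (Fin n) k)}
    (hN : ∀ w ∈ Wt, ∀ g ∈ G, w * g * w⁻¹ ∈ G) {w : Matrix.GeneralLinearGroup (Fin n) k}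
    (hw : w ∈ Wt) {f : MvPolynomial (Fin n) k} (hf : f ∈ invariants G) :
    matAct w f ∈ invariants G := by
  intro g hg
  have h := hN w⁻¹ (inv_mem hw) g hg
  rw [inv_inv] at h
  have h2 := hf _ h
  have h3 : matAct (g * w) f = matAct (w * (w⁻¹ * g * w)) f := by group
  rw [matAct_mul, AlgHom.comp_apply, matAct_mul w, AlgHom.comp_apply, h2] at h3
  exact h3

/-- The linear form with coefficient vector `a`. -/
def linForm : (Fin n → k) →ₗ[k] MvPolynomial (Fin n) k :=
  Fintype.linearCombination k X

lemma linForm_apply (a : Fin n → k) : linForm a = ∑ i, a i • (X i : MvPolynomial (Fin n) k) := rfl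

lemma eval_linForm (a x : Fin n → k) : eval x (linForm a) = a ⬝ᵥ x := by
  simp [linForm_apply, dotProduct, smul_eq_C_mul]

lemma linForm_isHomogeneous (a : Fin n → k) : (linForm a).IsHomogeneous 1 := by
  rw [linForm_apply]
  refine (weightedHomogeneousSubmodule k 1 1).sum_mem fun j _ => ?_
  rw [smul_eq_C_mul]
  exact IsHomogeneous.C_mul (isHomogeneous_X k j) _

lemma exists_linForm {f : MvPolynomial (Fin n) k} (hf : f.IsHomogeneous 1) :
    ∃ a, f = linForm a := by
  have h : f ∈ homogeneousSubmodule (Fin n) k 1 := hf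
  rw [homogeneousSubmodule_one_eq_span_X, Submodule.mem_span_range_iff_exists_fun] at h
  obtain ⟨a, ha⟩ := h
  exact ⟨a, ha.symm⟩

lemma linForm_injective : Function.Injective (linForm (k := k) (n := n)) := by
  intro a b h
  funext i
  have := congrArg (eval (Pi.single i 1)) h
  simpa [eval_linForm] using this

lemma linForm_ne_zero {a : Fin n → k} (ha : a ≠ 0) : linForm a ≠ 0 := by
  rw [← map_zero linForm]
  exact fun h => ha (linForm_injective h)

/-- Two linear forms, the first of which vanishes only where the second does, are proportional. -/
lemma exists_eq_smul_of_vanish {a b : Fin n → k} (h : ∀ x, a ⬝ᵥ x = 0 → b ⬝ᵥ x = 0) :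
    ∃ t : k, b = t • a := by
  by_cases ha : ∀ x, a ⬝ᵥ x = 0
  · refine ⟨0, ?_⟩
    rw [zero_smul]
    funext i
    simpa using h (Pi.single i 1) (ha _)
  · push Not at ha
    obtain ⟨x₀, hx₀⟩ := ha
    refine ⟨b ⬝ᵥ x₀ / a ⬝ᵥ x₀, ?_⟩
    funext i
    have := h (Pi.single i 1 - (a i / a ⬝ᵥ x₀) • x₀) (by
      rw [dotProduct_sub, dotProduct_smul, smul_eq_mul, div_mul_cancel₀ _ hx₀]; simp)
    rw [dotProduct_sub, dotProduct_smul, sub_eq_zero] at this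
    simp only [dotProduct_single, mul_one, smul_eq_mul] at this
    rw [this, Pi.smul_apply, smul_eq_mul]
    ring

lemma exists_eq_smul_of_eval {f g : MvPolynomial (Fin n) k} (hf : f.IsHomogeneous 1)
    (hg : g.IsHomogeneous 1) (h : ∀ x, eval x f = 0 → eval x g = 0) : ∃ t : k, g = t • f := by
  obtain ⟨a, rfl⟩ := exists_linForm hf
  obtain ⟨b, rfl⟩ := exists_linForm hg
  simp_rw [eval_linForm] at h
  obtain ⟨t, rfl⟩ := exists_eq_smul_of_vanish h
  exact ⟨t, map_smul _ _ _⟩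

/-- The matrix `s` fixes the hyperplane defined by `ℓ` pointwise iff it moves the coordinates by
multiples of `ℓ`. -/
lemma exists_matAct_X {s : Matrix.GeneralLinearGroup (Fin n) k}
    {ℓ : MvPolynomial (Fin n) k} (hℓ : ℓ.IsHomogeneous 1)
    (hs : ∀ x, eval x ℓ = 0 → Matrix.mulVec (s : Matrix (Fin n) (Fin n) k) x = x) :
    ∃ b : Fin n → k, ∀ i, matAct s (X i) = X i + b i • ℓ := by
  have h : ∀ i, ∃ t : k, matAct s (X i) - X i = t • ℓ := by
    intro i
    refine exists_eq_smul_of_eval hℓ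
      ((matAct_isHomogeneous s (isHomogeneous_X k i)).sub (isHomogeneous_X k i)) fun x hx => ?_
    rw [map_sub, eval_matAct, eval_X, eval_X]
    have h1 := hs x hx
    have h2 : Matrix.mulVec (↑(s⁻¹) : Matrix (Fin n) (Fin n) k) x = x := by
      conv_lhs => rw [← h1]
      rw [Matrix.mulVec_mulVec, ← Units.val_mul, inv_mul_cancel, Units.val_one, Matrix.one_mulVec]
    rw [h2, sub_self]
  choose b hb using h
  exact ⟨b, fun i => by rw [← hb, add_sub_cancel]⟩

end MatrixAction

section Setup

variable {n m : ℕ} {Wt G : Subgroup (Matrix.GeneralLinearGroup (Fin n) k)}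
  {p : Fin m → MvPolynomial (Fin n) k} {d : Fin m → ℕ} {c : ↥Wt → Fin m → Fin m → k}

namespace QuotSetup

lemma linearIndependent (hs : QuotSetup Wt G p d c) : LinearIndependent k p := by
  rw [Fintype.linearIndependent_iff]
  intro a ha i
  have := hs.minimal a (by rw [ha]; exact zero_mem _)
  rw [this]; rfl

lemma c_mul (hs : QuotSetup Wt G p d c) (v w : ↥Wt) (i j : Fin m) :
    c (v * w) i j = ∑ l, c w i l * c v l j := by
  have h := hs.equivar (v * w) i
  rw [Subgroup.coe_mul, matAct_mul, AlgHom.comp_apply, hs.equivar, map_sum] at h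
  simp_rw [map_smul, hs.equivar, Finset.smul_sum, smul_smul] at h
  rw [Finset.sum_comm] at h
  simp_rw [← Finset.sum_smul] at h
  exact (Fintype.linearIndependent_iffₛ.1 hs.linearIndependent _ _ h j).symm

lemma c_one (hs : QuotSetup Wt G p d c) (i j : Fin m) : c 1 i j = if i = j then 1 else 0 := by
  have h := hs.equivar 1 i
  rw [Subgroup.coe_one, matAct_one] at h
  have h2 : ∑ j, (if i = j then (1 : k) else 0) • p j = ∑ j, c 1 i j • p j := by
    rw [← h]; simp
  exact (Fintype.linearIndependent_iffₛ.1 hs.linearIndependent _ _ h2 j).symm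

/-- The action of the group on polynomial functions on `V`. -/
def rep (hs : QuotSetup Wt G p d c) :
    ↥Wt →* (MvPolynomial (Fin m) k →ₐ[k] MvPolynomial (Fin m) k) where
  toFun w := polyAct (c w)
  map_one' := by
    ext i : 1
    simp [polyAct, hs.c_one]
  map_mul' v w := by
    ext i : 1
    change polyAct _ _ = polyAct (c v) (polyAct (c w) (X i))
    simp only [polyAct, aeval_X, map_sum, map_smul, Finset.smul_sum, smul_smul, hs.c_mul,
      Finset.sum_smul]
    rw [Finset.sum_comm]

lemma rep_apply (hs : QuotSetup Wt G p d c) (w : ↥Wt) : hs.rep w = polyAct (c w) := rfl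

lemma aeval_rep (hs : QuotSetup Wt G p d c) (w : ↥Wt) (f : MvPolynomial (Fin m) k) :
    aeval p (hs.rep w f) = matRep Wt w (aeval p f) := by
  have h : (aeval p).comp (hs.rep w) = (matRep Wt w).comp (aeval p) := by
    ext i : 1
    rw [AlgHom.comp_apply, AlgHom.comp_apply, hs.rep_apply, matRep_apply]
    simp only [polyAct, aeval_X, map_sum, map_smul, hs.equivar]
  exact DFunLike.congr_fun h f

lemma d_ne_zero (hs : QuotSetup Wt G p d c) (i : Fin m) : d i ≠ 0 := (hs.dpos i).ne'

lemma preservesWeight (hs : QuotSetup Wt G p d c) : PreservesWeight hs.rep d := by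
  intro w f D hf
  refine isWeightedHomogeneous_map _ (fun i => ?_) hf
  rw [rep_apply, polyAct, aeval_X]
  refine (weightedHomogeneousSubmodule k d (d i)).sum_mem fun j _ => ?_
  by_cases hij : d j = d i
  · rw [smul_eq_C_mul, ← hij]
    exact IsWeightedHomogeneous.C_mul (isWeightedHomogeneous_X k d j) _
  · have h0 : c w i j = 0 := by
      have h1 := congrArg (homogeneousComponent (d j)) (hs.equivar w i)
      rw [homogeneousComponent_of_mem (matAct_isHomogeneous _ (hs.homog i)), if_neg hij,
        map_sum] at h1
      simp_rw [map_smul, homogeneousComponent_of_mem (hs.homog _)] at h1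
      have h2 := Fintype.linearIndependent_iff.1 hs.linearIndependent
        (fun l => if d j = d l then c w i l else 0) (by
          refine Eq.trans (Finset.sum_congr rfl fun l _ => ?_) h1.symm
          split_ifs <;> simp) j
      simpa using h2
    rw [h0, zero_smul]
    exact zero_mem _

lemma matRep_preservesWeight (W : Subgroup (Matrix.GeneralLinearGroup (Fin n) k)) :
    PreservesWeight (matRep W) 1 :=
  fun w _ _ hf => matAct_isHomogeneous w.1 hf

lemma constantCoeff_p (hs : QuotSetup Wt G p d c) (i : Fin m) : constantCoeff (p i) = 0 :=
  constantCoeff_eq_zero_of_homogeneous (w := 1) (hs.homog i) (hs.d_ne_zero i)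

lemma aeval_mem (hs : QuotSetup Wt G p d c) (f : MvPolynomial (Fin m) k) :
    aeval p f ∈ invariants G := by
  rw [← hs.gen, Algebra.adjoin_range_eq_range_aeval]
  exact ⟨f, rfl⟩

lemma exists_aeval_eq (hs : QuotSetup Wt G p d c) {f : MvPolynomial (Fin n) k}
    (hf : f ∈ invariants G) : ∃ h : MvPolynomial (Fin m) k, aeval p h = f := by
  rw [← hs.gen, Algebra.adjoin_range_eq_range_aeval] at hf
  exact hf

lemma p_mem (hs : QuotSetup Wt G p d c) (i : Fin m) : p i ∈ invariants G := by
  rw [← hs.gen]; exact Algebra.subset_adjoin ⟨i, rfl⟩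

lemma rep_mem_relIdeal (hs : QuotSetup Wt G p d c) (w : ↥Wt) :
    ∀ f ∈ relIdeal p, hs.rep w f ∈ relIdeal p := by
  intro f hf
  change aeval p (hs.rep w f) = 0
  rw [hs.aeval_rep, show aeval p f = 0 from hf, map_zero]

lemma rep_mem_idealPlus (hs : QuotSetup Wt G p d c) (w : ↥Wt) :
    ∀ f ∈ idealPlus k m, hs.rep w f ∈ idealPlus k m := by
  intro f hf
  have : idealPlus k m ≤ (idealPlus k m).comap (hs.rep w) := by
    refine Ideal.span_le.2 ?_
    rintro _ ⟨i, rfl⟩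
    change polyAct (c w) (X i) ∈ idealPlus k m
    rw [polyAct, aeval_X]
    refine sum_mem fun j _ => ?_
    rw [smul_eq_C_mul]
    exact Ideal.mul_mem_left _ _ (Ideal.subset_span ⟨j, rfl⟩)
  exact this hf

lemma rep_mem_mul (hs : QuotSetup Wt G p d c) (w : ↥Wt) :
    ∀ f ∈ idealPlus k m * relIdeal p, hs.rep w f ∈ idealPlus k m * relIdeal p := by
  intro f hf
  have : idealPlus k m * relIdeal p ≤ (idealPlus k m * relIdeal p).comap (hs.rep w) := by
    refine Ideal.mul_le.2 fun a ha b hb => ?_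
    rw [Ideal.mem_comap, map_mul]
    exact Ideal.mul_mem_mul (hs.rep_mem_idealPlus w a ha) (hs.rep_mem_relIdeal w b hb)
  exact this hf

/-- An invariant without constant term is a combination of the generators modulo products. -/
lemma exists_sub_mem_sqSpan (hs : QuotSetup Wt G p d c) {f : MvPolynomial (Fin n) k}
    (hf : f ∈ invariants G) (hf0 : constantCoeff f = 0) :
    ∃ a : Fin m → k, f - ∑ i, a i • p i ∈ sqSpan G := by
  suffices h : ∃ a : Fin m → k, f - C (constantCoeff f) - ∑ i, a i • p i ∈ sqSpan G by
    simpa [hf0] using h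
  clear hf0
  have hC : ∀ r : k, C r ∈ invariants G := fun r => Subalgebra.algebraMap_mem _ r
  rw [← hs.gen] at hf
  induction hf using Algebra.adjoin_induction with
  | mem x hx =>
    obtain ⟨i, rfl⟩ := hx
    refine ⟨Pi.single i 1, ?_⟩
    simp [hs.constantCoeff_p, Pi.single_apply, ite_smul]
  | algebraMap r => exact ⟨0, by simp [algebraMap_eq]⟩
  | add x y _ _ hx hy =>
    obtain ⟨a, ha⟩ := hx
    obtain ⟨b, hb⟩ := hy
    refine ⟨a + b, ?_⟩
    convert add_mem ha hb using 1
    simp only [map_add, Pi.add_apply, add_smul, Finset.sum_add_distrib]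
    ring
  | mul x y hx' hy' hx hy =>
    rw [hs.gen] at hx' hy'
    obtain ⟨a, ha⟩ := hx
    obtain ⟨b, hb⟩ := hy
    refine ⟨constantCoeff x • b + constantCoeff y • a, ?_⟩
    have h1 : (x - C (constantCoeff x)) * (y - C (constantCoeff y)) ∈ sqSpan G :=
      Submodule.subset_span ⟨_, sub_mem hx' (hC _), _, sub_mem hy' (hC _), by simp, by simp, rfl⟩
    convert add_mem h1 (add_mem ((sqSpan G).smul_mem (constantCoeff x) hb)
      ((sqSpan G).smul_mem (constantCoeff y) ha)) using 1
    simp only [map_mul, Pi.add_apply, Pi.smul_apply, add_smul, Finset.sum_add_distrib, smul_sub,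
      smul_eq_mul, mul_smul, Finset.smul_sum]
    simp only [smul_eq_C_mul]
    ring

/-- The reflections in a reflection group. -/
def refls (Wt : Subgroup (Matrix.GeneralLinearGroup (Fin n) k)) : Set ↥Wt :=
  {s | IsReflection ((s : Matrix.GeneralLinearGroup (Fin n) k) : Matrix (Fin n) (Fin n) k)}

lemma closure_refls (hs : QuotSetup Wt G p d c) : Subgroup.closure (refls Wt) = ⊤ := by
  refine Subgroup.map_injective Wt.subtype_injective ?_
  rw [MonoidHom.map_closure, ← MonoidHom.range_eq_map, Subgroup.range_subtype]
  conv_rhs => rw [← hs.reflGroup]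
  congr 1
  ext g
  constructor
  · rintro ⟨s, hs, rfl⟩; exact ⟨s.2, hs⟩
  · rintro ⟨h1, h2⟩; exact ⟨⟨g, h1⟩, h2, rfl⟩

end QuotSetup

end Setup

section Hyperplanes

variable {n : ℕ} {Wt G : Subgroup (Matrix.GeneralLinearGroup (Fin n) k)}

lemma linForm_prime {a : Fin n → k} (ha : a ≠ 0) : Prime (linForm a) := by
  have h0 := linForm_ne_zero ha
  have h1 := (linForm_isHomogeneous a).totalDegree h0
  refine (irreducible_of_totalDegree_eq_one h1 fun x hx => ?_).prime
  rw [isUnit_iff_ne_zero]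
  rintro rfl
  refine h0 ?_
  ext i
  rw [coeff_zero]
  exact zero_dvd_iff.1 (hx i)

/-- A choice of linear forms defining the reflecting hyperplanes. -/
def IsDefining (Wt : Subgroup (Matrix.GeneralLinearGroup (Fin n) k))
    (α : Submodule k (Fin n → k) → MvPolynomial (Fin n) k) : Prop :=
  ∀ H ∈ reflHyps Wt, (α H).IsHomogeneous 1 ∧ ∀ x : Fin n → k, eval x (α H) = 0 ↔ x ∈ H

lemma reflHyps_finite (hW : (Wt : Set (Matrix.GeneralLinearGroup (Fin n) k)).Finite) :
    (reflHyps Wt).Finite := by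
  refine (hW.image fun g : Matrix.GeneralLinearGroup (Fin n) k => LinearMap.ker
    (Matrix.toLin' (g : Matrix (Fin n) (Fin n) k) - LinearMap.id)).subset ?_
  rintro H ⟨g, hg, -, rfl⟩
  exact ⟨g, hg, rfl⟩

lemma reflHyps_ne_top {H : Submodule k (Fin n → k)} (hH : H ∈ reflHyps Wt) : H ≠ ⊤ := by
  obtain ⟨g, -, ⟨-, hg⟩, rfl⟩ := hH
  intro h
  rw [h, finrank_top, Module.finrank_fin_fun] at hg
  omega

variable {α : Submodule k (Fin n → k) → MvPolynomial (Fin n) k}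

lemma IsDefining.exists_linForm (hα : IsDefining Wt α) {H : Submodule k (Fin n → k)}
    (hH : H ∈ reflHyps Wt) :
    ∃ a : Fin n → k, a ≠ 0 ∧ α H = linForm a ∧ ∀ x, a ⬝ᵥ x = 0 ↔ x ∈ H := by
  obtain ⟨a, ha⟩ := ReflQuot.exists_linForm (hα H hH).1
  have h2 := (hα H hH).2
  simp_rw [ha, eval_linForm] at h2
  refine ⟨a, ?_, ha, h2⟩
  rintro rfl
  refine reflHyps_ne_top hH ?_
  rw [Submodule.eq_top_iff']
  exact fun x => (h2 x).1 (zero_dotProduct x)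

lemma IsDefining.prime (hα : IsDefining Wt α) {H : Submodule k (Fin n → k)}
    (hH : H ∈ reflHyps Wt) : Prime (α H) := by
  obtain ⟨a, ha, h, -⟩ := hα.exists_linForm hH
  rw [h]
  exact linForm_prime ha

lemma IsDefining.eq_of_dvd (hα : IsDefining Wt α) {H H' : Submodule k (Fin n → k)}
    (hH : H ∈ reflHyps Wt) (hH' : H' ∈ reflHyps Wt) (h : α H ∣ α H') : H = H' := by
  obtain ⟨t, ht⟩ := exists_eq_smul_of_eval (hα H hH).1 (hα H' hH').1 (fun x hx => by
    obtain ⟨q, hq⟩ := h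
    rw [hq, map_mul, hx, zero_mul])
  have ht0 : t ≠ 0 := by
    rintro rfl
    rw [zero_smul] at ht
    exact (hα.prime hH').ne_zero ht
  ext x
  rw [← (hα H hH).2 x, ← (hα H' hH').2 x, ht, smul_eval, mul_eq_zero, or_iff_right ht0]

lemma IsDefining.isRelPrime (hα : IsDefining Wt α) {H H' : Submodule k (Fin n → k)}
    (hH : H ∈ reflHyps Wt) (hH' : H' ∈ reflHyps Wt) (h : H ≠ H') : IsRelPrime (α H) (α H') :=
  (hα.prime hH).irreducible.isRelPrime_iff_not_dvd.2 fun hd => h (hα.eq_of_dvd hH hH' hd)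

/-- An element fixing a reflecting hyperplane pointwise moves every polynomial by a multiple of the
defining form. -/
lemma IsDefining.dvd_sub (hα : IsDefining Wt α) {H : Submodule k (Fin n → k)}
    (hH : H ∈ reflHyps Wt) {s : Matrix.GeneralLinearGroup (Fin n) k} (hs : s ∈ pointStab H)
    (f : MvPolynomial (Fin n) k) : α H ∣ matAct s f - f := by
  obtain ⟨b, hb⟩ := exists_matAct_X (s := s) (hα H hH).1
    fun x hx => hs x (((hα H hH).2 x).1 hx)
  obtain ⟨g, hg, -⟩ := exists_quotient _ (hα H hH).1 b hb f
  exact ⟨g, hg⟩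

lemma mem_pointStab_ker (s : Matrix.GeneralLinearGroup (Fin n) k) :
    s ∈ pointStab (LinearMap.ker
      (Matrix.toLin' (s : Matrix (Fin n) (Fin n) k) - LinearMap.id)) := by
  intro x hx
  simpa [sub_eq_zero] using hx

lemma isPseudoReflection_matRep {s : ↥Wt} (hs : s ∈ QuotSetup.refls Wt)
    (hα : IsDefining Wt α) : IsPseudoReflection (matRep Wt s) := by
  have hH : _ ∈ reflHyps Wt := ⟨s.1, s.2, hs, rfl⟩
  obtain ⟨b, hb⟩ := exists_matAct_X (s := s.1) (hα _ hH).1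
    fun x hx => mem_pointStab_ker s.1 x (((hα _ hH).2 x).1 hx)
  exact isPseudoReflection_of_linear _ (hα _ hH).1 b hb

lemma imageEq_refl (H : Submodule k (Fin n → k)) : imageEq Wt G H H := rfl

/-- The product of the defining forms of the hyperplanes equivalent to `H`. -/
def classProd (Wt G : Subgroup (Matrix.GeneralLinearGroup (Fin n) k))
    (α : Submodule k (Fin n → k) → MvPolynomial (Fin n) k) (H : Submodule k (Fin n → k)) :
    MvPolynomial (Fin n) k :=
  ∏ᶠ H' ∈ {H' | H' ∈ reflHyps' Wt G ∧ imageEq Wt G H H'}, α H'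

lemma class_finite (hW : (Wt : Set (Matrix.GeneralLinearGroup (Fin n) k)).Finite)
    (H : Submodule k (Fin n → k)) :
    {H' | H' ∈ reflHyps' Wt G ∧ imageEq Wt G H H'}.Finite :=
  (reflHyps_finite hW).subset fun _ h => h.1.1

lemma classProd_eq (hW : (Wt : Set (Matrix.GeneralLinearGroup (Fin n) k)).Finite)
    (H : Submodule k (Fin n → k)) :
    classProd Wt G α H = ∏ H' ∈ (class_finite (G := G) hW H).toFinset, α H' :=
  finprod_mem_eq_finite_toFinset_prod _ _

lemma IsDefining.classProd_dvd (hα : IsDefining Wt α)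
    (hW : (Wt : Set (Matrix.GeneralLinearGroup (Fin n) k)).Finite)
    (H : Submodule k (Fin n → k)) {f : MvPolynomial (Fin n) k}
    (h : ∀ H' ∈ reflHyps' Wt G, imageEq Wt G H H' → α H' ∣ f) : classProd Wt G α H ∣ f := by
  rw [classProd_eq hW]
  refine Finset.prod_dvd_of_isRelPrime (fun H₁ h₁ H₂ h₂ hne => ?_) fun H' h' => ?_
  · simp only [Set.Finite.coe_toFinset, Set.mem_ofPred_eq] at h₁ h₂
    exact hα.isRelPrime h₁.1.1 h₂.1.1 hne
  · simp only [Set.Finite.mem_toFinset, Set.mem_ofPred_eq] at h'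
    exact h H' h'.1 h'.2

lemma IsDefining.classProd_ne_zero (hα : IsDefining Wt α)
    (hW : (Wt : Set (Matrix.GeneralLinearGroup (Fin n) k)).Finite)
    (H : Submodule k (Fin n → k)) : classProd Wt G α H ≠ 0 := by
  rw [classProd_eq hW, Finset.prod_ne_zero_iff]
  intro H' h'
  simp only [Set.Finite.mem_toFinset, Set.mem_ofPred_eq] at h'
  exact (hα.prime h'.1.1).ne_zero

lemma dvd_classProd (hW : (Wt : Set (Matrix.GeneralLinearGroup (Fin n) k)).Finite)
    {H H' : Submodule k (Fin n → k)} (hH : H' ∈ reflHyps' Wt G) (h : imageEq Wt G H H') :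
    α H' ∣ classProd Wt G α H := by
  rw [classProd_eq hW]
  exact Finset.dvd_prod_of_mem _ (by simpa using ⟨hH, h⟩)

/-- An element with the same image as the stabilizer of `H` moves invariants by multiples of the
class product. -/
lemma IsDefining.classProd_dvd_sub (hα : IsDefining Wt α)
    (hW : (Wt : Set (Matrix.GeneralLinearGroup (Fin n) k)).Finite)
    (hN : ∀ w ∈ Wt, ∀ g ∈ G, w * g * w⁻¹ ∈ G)
    {H : Submodule k (Fin n → k)} {s : Matrix.GeneralLinearGroup (Fin n) k} (hsW : s ∈ Wt)
    (hs : s ∈ pointStab H) {f : MvPolynomial (Fin n) k} (hf : f ∈ invariants G) :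
    classProd Wt G α H ∣ matAct s f - f := by
  refine hα.classProd_dvd hW H fun H' hH' himg => ?_
  have hmem : s ∈ {x | ∃ g ∈ G, ∃ u ∈ Wt ⊓ pointStab H, x = g * u} :=
    ⟨1, one_mem G, s, ⟨hsW, hs⟩, (one_mul s).symm⟩
  rw [himg] at hmem
  obtain ⟨g, hg, u, ⟨huW, hu⟩, rfl⟩ := hmem
  rw [matAct_mul, AlgHom.comp_apply, matAct_mem_invariants hN huW hf g hg]
  exact hα.dvd_sub hH'.1 hu f

end Hyperplanes

section Sufficiency

variable {n m : ℕ} {Wt G : Subgroup (Matrix.GeneralLinearGroup (Fin n) k)}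
  {p : Fin m → MvPolynomial (Fin n) k} {d : Fin m → ℕ} {c : ↥Wt → Fin m → Fin m → k}
  {α : Submodule k (Fin n → k) → MvPolynomial (Fin n) k}

namespace QuotSetup

/-- The hyperplane of a reflection not in `G`. -/
lemma ker_mem_reflHyps' (hnorefl : ∀ g ∈ G, ¬ IsReflection (g : Matrix (Fin n) (Fin n) k))
    {s : ↥Wt} (hsr : s ∈ refls Wt) :
    LinearMap.ker (Matrix.toLin' (s.1 : Matrix (Fin n) (Fin n) k) - LinearMap.id) ∈
      reflHyps' Wt G :=
  ⟨⟨s.1, s.2, hsr, rfl⟩, fun h => hnorefl s.1 (h ⟨s.2, mem_pointStab_ker s.1⟩) hsr⟩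

/-- If the class products are invariant, reflections act on `V` by substitutions fixing a
hyperplane. -/
lemma exists_rep_eq (hs : QuotSetup Wt G p d c)
    (hnorefl : ∀ g ∈ G, ¬ IsReflection (g : Matrix (Fin n) (Fin n) k))
    (hα : IsDefining Wt α) (hC : ∀ H ∈ reflHyps' Wt G, classProd Wt G α H ∈ invariants G)
    {s : ↥Wt} (hsr : s ∈ refls Wt) :
    ∃ (a b : Fin m → k), ∀ i, hs.rep s (X i) = X i + b i • linForm a := by
  set H := LinearMap.ker (Matrix.toLin' (s.1 : Matrix (Fin n) (Fin n) k) - LinearMap.id) with hHdef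
  have hH : H ∈ reflHyps' Wt G := ker_mem_reflHyps' hnorefl hsr
  set δ := classProd Wt G α H with hδ
  have hδ0 : δ ≠ 0 := hα.classProd_ne_zero hs.finite H
  have hδinv : δ ∈ invariants G := hC H hH
  have hδcc : constantCoeff δ = 0 := by
    obtain ⟨q, hq⟩ := dvd_classProd (α := α) hs.finite hH (imageEq_refl H)
    rw [hδ, hq, map_mul,
      constantCoeff_eq_zero_of_homogeneous (w := 1) (hα H hH.1).1 one_ne_zero, zero_mul]
  choose g hg using fun i => hα.classProd_dvd_sub hs.finite hs.normal s.2
    (mem_pointStab_ker s.1) (hs.p_mem i)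
  have hginv : ∀ i, g i ∈ invariants G := by
    intro i w hw
    have h1 : matAct w (matAct s.1 (p i) - p i) = matAct s.1 (p i) - p i :=
      sub_mem (matAct_mem_invariants hs.normal s.2 (hs.p_mem i)) (hs.p_mem i) w hw
    rw [hg i, map_mul, ← hδ, hδinv w hw] at h1
    exact mul_left_cancel₀ hδ0 h1
  obtain ⟨a, ha⟩ := hs.exists_sub_mem_sqSpan hδinv hδcc
  refine ⟨a, fun i => constantCoeff (g i), fun i => ?_⟩
  have h1 : ∑ j, (c s i j - (if i = j then 1 else 0) - constantCoeff (g i) * a j) • p j =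
      constantCoeff (g i) • (δ - ∑ j, a j • p j) + δ * (g i - C (constantCoeff (g i))) := by
    have h2 := hg i
    rw [hs.equivar] at h2
    simp_rw [sub_smul, Finset.sum_sub_distrib, mul_smul, ← Finset.smul_sum]
    have h3 : ∑ j, (if i = j then (1 : k) else 0) • p j = p i := by simp
    rw [h3, h2, smul_eq_C_mul, smul_eq_C_mul]
    ring
  have h2 := hs.minimal _ (by
    rw [h1]
    exact add_mem ((sqSpan G).smul_mem _ ha) (Submodule.subset_span
      ⟨δ, hδinv, _, sub_mem (hginv i) (Subalgebra.algebraMap_mem _ _), hδcc, by simp, rfl⟩))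
  have h3 : ∀ j, c s i j = (if i = j then 1 else 0) + constantCoeff (g i) * a j := by
    intro j
    have := congrFun h2 j
    simp only [Pi.zero_apply] at this
    linear_combination this
  rw [rep_apply, polyAct, aeval_X]
  simp_rw [h3, add_smul, Finset.sum_add_distrib, mul_smul, ← Finset.smul_sum]
  congr 1
  simp

/-- Elements of a stable prime kernel are moved by reflections into products. -/
lemma exists_refl_quotient (hs : QuotSetup Wt G p d c) {s : ↥Wt} {a b : Fin m → k}
    (hab : ∀ i, hs.rep s (X i) = X i + b i • linForm a) {f : MvPolynomial (Fin m) k}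
    (hf : f ∈ relIdeal p) :
    ∃ g ∈ relIdeal p, hs.rep s f - f = linForm a * g ∧
      (g = 0 ∨ g.totalDegree < f.totalDegree) := by
  obtain ⟨g, hg, hg'⟩ := exists_quotient _ (linForm_isHomogeneous a) b hab f
  by_cases ha : a = 0
  · refine ⟨0, zero_mem _, ?_, Or.inl rfl⟩
    rw [hg, ha, map_zero, zero_mul, zero_mul]
  · refine ⟨g, ?_, hg, hg'⟩
    have h1 : aeval p (hs.rep s f - f) = 0 := by
      rw [map_sub, hs.aeval_rep, show aeval p f = 0 from hf, map_zero, sub_zero]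
    rw [hg, map_mul] at h1
    refine (mul_eq_zero.1 h1).resolve_left fun h => ha ?_
    rw [linForm_apply, map_sum] at h
    simp_rw [map_smul, aeval_X] at h
    exact funext (Fintype.linearIndependent_iff.1 hs.linearIndependent a h)

lemma trivialConormal (hs : QuotSetup Wt G p d c)
    (htrans : ∀ s ∈ refls Wt, ∃ (a b : Fin m → k), ∀ i, hs.rep s (X i) = X i + b i • linForm a) :
    TrivialConormal Wt p c := by
  intro w f hf
  refine act_sub_mem_of_closure hs.rep hs.rep_mem_mul hs.closure_refls (fun s hsr => ?_) w
  obtain ⟨a, b, hab⟩ := htrans s hsr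
  obtain ⟨g, hg, h, -⟩ := hs.exists_refl_quotient hab hf
  rw [h]
  refine Ideal.mul_mem_mul ?_ hg
  rw [linForm_apply]
  refine sum_mem fun j _ => ?_
  rw [smul_eq_C_mul]
  exact Ideal.mul_mem_left _ _ (Ideal.subset_span ⟨j, rfl⟩)

variable [CharZero k]

/-- The ideal of relations is generated by invariant relations. -/
lemma relIdeal_le_span_fixed (hs : QuotSetup Wt G p d c) [Fintype ↥Wt]
    (htrans : ∀ s ∈ refls Wt, ∃ (a b : Fin m → k), ∀ i, hs.rep s (X i) = X i + b i • linForm a) :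
    relIdeal p ≤ Ideal.span {f | f ∈ relIdeal p ∧ f ∈ fixedAlg hs.rep} := by
  intro f hf
  induction hN : f.totalDegree using Nat.strong_induction_on generalizing f with
  | _ N ih =>
    have hstab : ∀ w, ∀ f ∈ Ideal.span {f | f ∈ relIdeal p ∧ f ∈ fixedAlg hs.rep},
        hs.rep w f ∈ Ideal.span {f | f ∈ relIdeal p ∧ f ∈ fixedAlg hs.rep} := by
      intro w
      have : Ideal.span {f | f ∈ relIdeal p ∧ f ∈ fixedAlg hs.rep} ≤
          (Ideal.span {f | f ∈ relIdeal p ∧ f ∈ fixedAlg hs.rep}).comap (hs.rep w) := by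
        refine Ideal.span_le.2 fun u hu => ?_
        rw [SetLike.mem_coe, Ideal.mem_comap, hu.2 w]
        exact Ideal.subset_span hu
      exact fun f hf => this hf
    have h1 := avg_sub_mem hs.rep (act_sub_mem_of_closure hs.rep hstab hs.closure_refls (f := f)
      fun s hsr => by
        obtain ⟨a, b, hab⟩ := htrans s hsr
        obtain ⟨g, hg, h, hlt⟩ := hs.exists_refl_quotient hab hf
        rw [h]
        refine Ideal.mul_mem_left _ _ ?_
        rcases hlt with rfl | hlt
        · exact zero_mem _
        · exact ih _ (hN ▸ hlt) hg rfl)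
    have h2 : avg hs.rep f ∈ Ideal.span {f | f ∈ relIdeal p ∧ f ∈ fixedAlg hs.rep} :=
      Ideal.subset_span ⟨avg_mem_submodule hs.rep (P := (relIdeal p).restrictScalars k)
        fun w => hs.rep_mem_relIdeal w f hf, avg_mem _ _⟩
    rwa [← Submodule.sub_mem_iff_right _ h2]

end QuotSetup

end Sufficiency

section Counting

lemma card_le_of_algebraicIndependent {ι : Type} [Fintype ι] {n : ℕ}
    {f : ι → MvPolynomial (Fin n) k} (hf : AlgebraicIndependent k f) : Fintype.card ι ≤ n := by
  have := hf.cardinalMk_le_trdeg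
  rw [MvPolynomial.trdeg_of_isDomain] at this
  simpa using this

/-- Generators of the invariants of a finite group acting on a polynomial ring in `n` variables are
at least `n` in number. -/
lemma le_card_of_adjoin_eq_fixedAlg {ι Γ : Type} [Fintype ι] [Group Γ] [Fintype Γ] {n : ℕ}
    (ρ : Γ →* (MvPolynomial (Fin n) k →ₐ[k] MvPolynomial (Fin n) k))
    {f : ι → MvPolynomial (Fin n) k} (hf : Algebra.adjoin k (Set.range f) = fixedAlg ρ) :
    n ≤ Fintype.card ι := by
  classical
  let : MulSemiringAction Γ (MvPolynomial (Fin n) k) :=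
    { smul := fun γ f => ρ γ f
      one_smul := act_one ρ
      mul_smul := act_mul ρ
      smul_zero := fun γ => map_zero (ρ γ)
      smul_add := fun γ => map_add (ρ γ)
      smul_one := fun γ => map_one (ρ γ)
      smul_mul := fun γ => map_mul (ρ γ) }
  have hinv : Algebra.IsInvariant (Algebra.adjoin k (Set.range f)) (MvPolynomial (Fin n) k) Γ :=
    ⟨fun b hb => ⟨⟨b, by rw [hf]; exact hb⟩, rfl⟩⟩
  have : SMulCommClass Γ (Algebra.adjoin k (Set.range f)) (MvPolynomial (Fin n) k) :=
    ⟨fun γ a b => by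
      have ha : (a : MvPolynomial (Fin n) k) ∈ fixedAlg ρ := hf ▸ a.2
      change ρ γ (a.1 * b) = a.1 * ρ γ b
      rw [map_mul, ha γ]⟩
  have := hinv.isIntegral
  have h := Algebra.IsAlgebraic.trdeg_le_cardinalMk k (Set.range f)
  rw [MvPolynomial.trdeg_of_isDomain] at h
  have h2 := h.trans Cardinal.mk_range_le
  simpa using h2

/-- Padding a generating set of an ideal of a polynomial ring. -/
lemma exists_finset_span_eq {m : ℕ} [CharZero k] {I : Ideal (MvPolynomial (Fin m) k)}
    {N : ℕ} (hN : I = ⊥ → N = 0) {Y : Finset (MvPolynomial (Fin m) k)} (hY : Ideal.span ↑Y = I)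
    (hcard : Y.card ≤ N) : ∃ s : Finset (MvPolynomial (Fin m) k), s.card = N ∧
      Ideal.span (s : Set (MvPolynomial (Fin m) k)) = I := by
  classical
  by_cases hI : I = ⊥
  · exact ⟨∅, by rw [hN hI]; rfl, by simp [hI]⟩
  · obtain ⟨f, hf, hf0⟩ := Submodule.exists_mem_ne_zero_of_ne_bot hI
    have hinf : Infinite I := by
      refine Infinite.of_injective (fun j : ℕ => (⟨(j : MvPolynomial (Fin m) k) * f,
        I.mul_mem_left _ hf⟩ : I)) fun i j hij => ?_
      have := congrArg Subtype.val hij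
      exact_mod_cast mul_right_cancel₀ hf0 this
    have hYI : ∀ y ∈ Y, y ∈ I := fun y hy => hY ▸ Ideal.subset_span hy
    obtain ⟨t, ht, htc⟩ := Infinite.exists_superset_card_eq (Y.subtype (· ∈ I)) N (by
      rw [Finset.card_subtype, Finset.filter_true_of_mem hYI]; exact hcard)
    refine ⟨t.map (Function.Embedding.subtype _), by rw [Finset.card_map, htc], le_antisymm ?_ ?_⟩
    · refine Ideal.span_le.2 fun y hy => ?_
      simp only [Finset.coe_map, Set.mem_image, SetLike.mem_coe] at hy
      obtain ⟨z, -, rfl⟩ := hy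
      exact z.2
    · refine hY.ge.trans (Ideal.span_mono ?_)
      intro y hy
      simp only [Finset.coe_map, Set.mem_image, SetLike.mem_coe]
      exact ⟨⟨y, hYI y hy⟩, ht (by simpa using hy), rfl⟩

variable {n m : ℕ} {Wt G : Subgroup (Matrix.GeneralLinearGroup (Fin n) k)}
  {p : Fin m → MvPolynomial (Fin n) k} {d : Fin m → ℕ} {c : ↥Wt → Fin m → Fin m → k}
  {α : Submodule k (Fin n → k) → MvPolynomial (Fin n) k}

namespace QuotSetup

lemma isHomogeneous_aeval (hs : QuotSetup Wt G p d c) {f : MvPolynomial (Fin m) k} {e : ℕ}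
    (hf : IsWeightedHomogeneous d f e) : (aeval p f).IsHomogeneous e := by
  rw [f.as_sum, map_sum]
  refine (weightedHomogeneousSubmodule k 1 e).sum_mem fun μ hμ => ?_
  rw [aeval_monomial, Finsupp.prod]
  refine IsHomogeneous.C_mul ?_ _
  have h2 := IsHomogeneous.prod μ.support (fun i => p i ^ μ i) (fun i => d i * μ i)
    fun i _ => (hs.homog i).pow (μ i)
  have h3 := hf (mem_support_iff.1 hμ)
  rw [Finsupp.weight_apply, Finsupp.sum] at h3
  simp_rw [smul_eq_mul, mul_comm (μ _)] at h3
  rwa [h3] at h2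

variable [CharZero k]

theorem isCompleteIntersection (hs : QuotSetup Wt G p d c) (hα : IsDefining Wt α)
    (htrans : ∀ s ∈ refls Wt, ∃ (a b : Fin m → k), ∀ i, hs.rep s (X i) = X i + b i • linForm a) :
    IsCompleteIntersection p := by
  classical
  have : Fintype ↥Wt := hs.finite.fintype
  obtain ⟨N, F₀, e₀, hF₀, he₀, hgen₀⟩ := exists_homogeneous_generators (ρ := hs.rep) hs.d_ne_zero
    hs.preservesWeight
  obtain ⟨S₀, hind₀, hgen⟩ := exists_basic_subfamily hs.closure_refls (fun s hsr => by
    obtain ⟨a, b, hab⟩ := htrans s hsr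
    exact isPseudoReflection_of_linear _ (linForm_isHomogeneous a) b hab) hs.d_ne_zero
    hs.preservesWeight F₀ e₀ hF₀ he₀ hgen₀
  set F : S₀ → MvPolynomial (Fin m) k := fun i => F₀ i with hF
  have hcardm : Fintype.card S₀ ≤ m := card_le_of_algebraicIndependent hind₀
  have hgenB : Algebra.adjoin k (Set.range fun i => aeval p (F i)) = fixedAlg (matRep Wt) := by
    refine le_antisymm (Algebra.adjoin_le ?_) fun u hu => ?_
    · rintro _ ⟨i, rfl⟩ w
      have : F i ∈ fixedAlg hs.rep := hgen ▸ Algebra.subset_adjoin ⟨i, rfl⟩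
      rw [← hs.aeval_rep, this w]
    · obtain ⟨v, hv⟩ := hs.exists_aeval_eq (f := u) fun g hg => hu ⟨g, hs.le hg⟩
      have h1 : aeval p (avg hs.rep v) = u := by
        rw [avg_apply, map_smul, map_sum]
        simp_rw [hs.aeval_rep, hv]
        rw [← avg_apply, avg_of_mem _ hu]
      have h2 : avg hs.rep v ∈ Algebra.adjoin k (Set.range F) := hgen ▸ avg_mem _ _
      rw [Algebra.adjoin_range_eq_range_aeval] at h2
      obtain ⟨Q, hQ⟩ := h2
      rw [Algebra.adjoin_range_eq_range_aeval]
      refine ⟨Q, ?_⟩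
      rw [← h1, ← hQ]
      change _ = aeval p (aeval F Q)
      rw [← AlgHom.comp_apply, comp_aeval]
      rfl
  obtain ⟨S, hind, hgenS⟩ := exists_basic_subfamily hs.closure_refls
    (fun s hsr => isPseudoReflection_matRep hsr hα) (w := 1) (fun _ => one_ne_zero)
    (matRep_preservesWeight Wt) (fun i => aeval p (F i)) (fun i => e₀ i)
    (fun i => hs.isHomogeneous_aeval (hF₀ i)) (fun i => he₀ i) hgenB
  have hcardn : n ≤ S.card := by
    have := le_card_of_adjoin_eq_fixedAlg (matRep Wt) hgenS
    simpa using this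
  have hP : ∀ j, ∃ P : MvPolynomial S k, aeval (fun i : S => aeval p (F i)) P = aeval p (F j) := by
    intro j
    have : aeval p (F j) ∈ Algebra.adjoin k (Set.range fun i : S => aeval p (F i)) := by
      rw [hgenS, ← hgenB]; exact Algebra.subset_adjoin ⟨j, rfl⟩
    rw [Algebra.adjoin_range_eq_range_aeval] at this
    exact this
  choose P hP using hP
  set FS : S → MvPolynomial (Fin m) k := fun i => F i with hFS
  have hFSp : ∀ Q : MvPolynomial S k, aeval p (aeval FS Q) =
      aeval (fun i : S => aeval p (F i)) Q := by
    intro Q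
    rw [← AlgHom.comp_apply, comp_aeval]
  set Y : Finset (MvPolynomial (Fin m) k) := Sᶜ.image fun j => F j - aeval FS (P j) with hYdef
  have hYcard : Y.card ≤ m - n := by
    refine Finset.card_image_le.trans ?_
    rw [Finset.card_compl]
    omega
  refine exists_finset_span_eq (fun hI => ?_) (Y := Y) (le_antisymm ?_ ?_) hYcard
  · have : AlgebraicIndependent k p := by
      rw [algebraicIndependent_iff_injective_aeval]
      exact (RingHom.injective_iff_ker_eq_bot _).2 hI
    have := card_le_of_algebraicIndependent this
    rw [Fintype.card_fin] at this
    omega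
  · refine Ideal.span_le.2 fun y hy => ?_
    simp only [hYdef, Finset.coe_image, Set.mem_image] at hy
    obtain ⟨j, -, rfl⟩ := hy
    change aeval p _ = 0
    rw [map_sub, hFSp, hP, sub_self]
  · refine (hs.relIdeal_le_span_fixed htrans).trans (Ideal.span_le.2 ?_)
    rintro f ⟨hf, hfinv⟩
    set K := Ideal.span (Y : Set (MvPolynomial (Fin m) k)) with hK
    set F' : S₀ → MvPolynomial S k := fun j => if hj : j ∈ S then X ⟨j, hj⟩ else P j with hF'
    have hmk : ∀ j, F j - aeval FS (F' j) ∈ K := by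
      intro j
      by_cases hj : j ∈ S
      · simp [hF', hj, hFS]
      · simp only [hF', hj, dite_false]
        exact Ideal.subset_span (by
          simp only [hYdef, Finset.coe_image]
          exact ⟨j, by simpa using hj, rfl⟩)
    rw [← hgen, Algebra.adjoin_range_eq_range_aeval] at hfinv
    obtain ⟨Q, hQ⟩ := hfinv
    change aeval F Q = f at hQ
    have h1 : f - aeval FS (aeval F' Q) ∈ K := by
      rw [← Ideal.Quotient.mk_eq_mk_iff_sub_mem, ← hQ]
      have : (Ideal.Quotient.mkₐ k K).comp (aeval F) =
          ((Ideal.Quotient.mkₐ k K).comp (aeval FS)).comp (aeval F') := by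
        ext j
        simp only [AlgHom.comp_apply, aeval_X]
        exact Ideal.Quotient.mk_eq_mk_iff_sub_mem _ _ |>.2 (hmk j)
      exact DFunLike.congr_fun this Q
    have h2 : aeval p (aeval FS (aeval F' Q)) = 0 := by
      have hK0 : K ≤ relIdeal p := by
        refine Ideal.span_le.2 fun y hy => ?_
        simp only [hYdef, Finset.coe_image, Set.mem_image] at hy
        obtain ⟨j, -, rfl⟩ := hy
        change aeval p _ = 0
        rw [map_sub, hFSp, hP, sub_self]
      have h3 := hK0 h1
      have h4 : f ∈ relIdeal p := hf
      have h5 := sub_mem h4 h3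
      rw [sub_sub_cancel] at h5
      exact h5
    rw [hFSp] at h2
    have h3 := (algebraicIndependent_iff.1 hind) _ h2
    rw [h3, map_zero, sub_zero] at h1
    exact h1

/-- Sufficiency: if the class products are invariant, then `G` is good. -/
theorem isGoodQuot (hs : QuotSetup Wt G p d c)
    (hnorefl : ∀ g ∈ G, ¬ IsReflection (g : Matrix (Fin n) (Fin n) k))
    (hα : IsDefining Wt α) (hC : ∀ H ∈ reflHyps' Wt G, classProd Wt G α H ∈ invariants G) :
    IsGoodQuot Wt p c :=
  ⟨hs.isCompleteIntersection hα fun _ hsr => hs.exists_rep_eq hnorefl hα hC hsr,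
    hs.trivialConormal fun _ hsr => hs.exists_rep_eq hnorefl hα hC hsr⟩

end QuotSetup

end Counting

section Points

/-- The maximal ideal of a rational point. -/
abbrev pointIdeal {n : ℕ} (x : Fin n → k) : Ideal (MvPolynomial (Fin n) k) :=
  RingHom.ker (eval x)

lemma sub_C_mem_pointIdeal {n : ℕ} (x : Fin n → k) (f : MvPolynomial (Fin n) k) :
    f - C (eval x f) ∈ pointIdeal x := by
  rw [RingHom.mem_ker, map_sub, eval_C, sub_self]

lemma pointIdeal_le_span {n : ℕ} (x : Fin n → k) :
    pointIdeal x ≤ Ideal.span (Set.range fun i => X i - C (x i)) := by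
  intro f hf
  set J := Ideal.span (Set.range fun i => (X i - C (x i) : MvPolynomial (Fin n) k)) with hJ
  have h : Ideal.Quotient.mkₐ k J = (Algebra.ofId k _).comp (aeval x) := by
    ext i
    simp only [AlgHom.comp_apply, aeval_X]
    exact (Ideal.Quotient.mk_eq_mk_iff_sub_mem _ _).2 (Ideal.subset_span ⟨i, rfl⟩)
  rw [← Ideal.Quotient.eq_zero_iff_mem]
  have h2 := DFunLike.congr_fun h f
  rw [AlgHom.comp_apply, aeval_eq_eval, show eval x f = 0 from hf, map_zero] at h2
  exact h2

lemma eval_pderiv_of_mem_sq {n : ℕ} {x : Fin n → k} {f : MvPolynomial (Fin n) k}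
    (hf : f ∈ pointIdeal x * pointIdeal x) (i : Fin n) : eval x (pderiv i f) = 0 := by
  induction hf using Submodule.mul_induction_on' with
  | mem_mul_mem a ha b hb =>
    rw [RingHom.mem_ker] at ha hb
    rw [Derivation.leibniz, map_add, smul_eq_mul, smul_eq_mul, map_mul, map_mul, ha, hb, zero_mul,
      zero_mul, add_zero]
  | add a _ b _ ha hb => rw [map_add, map_add, ha, hb, add_zero]

lemma linForm_eq_zero_of_mem_sq {n : ℕ} {x a : Fin n → k}
    (h : linForm a ∈ pointIdeal x * pointIdeal x) : linForm a = 0 := by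
  have : a = 0 := by
    funext i
    have h1 := eval_pderiv_of_mem_sq h i
    simpa [linForm_apply, pderiv_X, Pi.single_apply, smul_eval] using h1
  rw [this, map_zero]

variable {n m : ℕ} {Wt G : Subgroup (Matrix.GeneralLinearGroup (Fin n) k)}

/-- A function separating a point with trivial stabilizer from the rest of its orbit. -/
lemma exists_separating [Fintype ↥G] {x : Fin n → k}
    (hx : ∀ g ∈ G, Matrix.mulVec (g : Matrix (Fin n) (Fin n) k) x = x → g = 1) :
    ∃ E : MvPolynomial (Fin n) k, eval x E = 1 ∧
      ∀ g : ↥G, g ≠ 1 → eval x (matAct g.1 E) = 0 := by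
  classical
  have h : ∀ g : ↥G, ∃ e : MvPolynomial (Fin n) k, g ≠ 1 → eval x e = 1 ∧
      eval x (matAct g.1 e) = 0 := by
    intro g
    by_cases hg : g = 1
    · exact ⟨0, fun h => absurd hg h⟩
    · set y := Matrix.mulVec (↑((g.1)⁻¹) : Matrix (Fin n) (Fin n) k) x with hy
      have hne : y ≠ x := fun h => hg (Subtype.ext (inv_eq_one.1
        (hx _ (inv_mem g.2) h)))
      obtain ⟨i, hi⟩ := Function.ne_iff.1 hne
      refine ⟨C (x i - y i)⁻¹ * (X i - C (y i)), fun _ => ⟨?_, ?_⟩⟩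
      · simp only [map_mul, eval_C, map_sub, eval_X]
        exact inv_mul_cancel₀ (sub_ne_zero.2 (Ne.symm hi))
      · rw [eval_matAct, ← hy]
        simp
  choose e he using h
  refine ⟨∏ g ∈ Finset.univ.erase 1, e g, ?_, fun g hg => ?_⟩
  · rw [map_prod]
    exact Finset.prod_eq_one fun g hg => (he g (Finset.ne_of_mem_erase hg)).1
  · rw [map_prod, map_prod]
    exact Finset.prod_eq_zero (Finset.mem_erase.2 ⟨hg, Finset.mem_univ _⟩) (he g hg).2

/-- The ideal generated by invariants vanishing at a point. -/
def invPointIdeal (G : Subgroup (Matrix.GeneralLinearGroup (Fin n) k)) (x : Fin n → k) :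
    Ideal (MvPolynomial (Fin n) k) :=
  Ideal.span {u | u ∈ invariants G ∧ u ∈ pointIdeal x}

/-- Invariants separate tangent vectors at a point with trivial stabilizer. -/
lemma pointIdeal_le_sup [Fintype ↥G] {x : Fin n → k}
    (hx : ∀ g ∈ G, Matrix.mulVec (g : Matrix (Fin n) (Fin n) k) x = x → g = 1) :
    pointIdeal x ≤ invPointIdeal G x ⊔ pointIdeal x * pointIdeal x := by
  classical
  obtain ⟨E, hE, hE'⟩ := exists_separating hx
  refine (pointIdeal_le_span x).trans (Ideal.span_le.2 ?_)
  rintro _ ⟨i, rfl⟩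
  set L : MvPolynomial (Fin n) k := X i - C (x i) with hL
  have hLx : L ∈ pointIdeal x := by simp [hL]
  set u := ∑ g : ↥G, matRep G g (E ^ 2 * L) with hu
  have hu1 : ∀ g : ↥G, g ≠ 1 → matRep G g (E ^ 2 * L) ∈ pointIdeal x * pointIdeal x := by
    intro g hg
    rw [map_mul, map_pow, pow_two]
    exact Ideal.mul_mem_right _ _ (Ideal.mul_mem_mul (hE' g hg) (hE' g hg))
  have hu2 : u - L ∈ pointIdeal x * pointIdeal x := by
    rw [hu, ← Finset.add_sum_erase _ _ (Finset.mem_univ 1), act_one, add_sub_right_comm]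
    refine add_mem ?_ (sum_mem fun g hg => hu1 g (Finset.ne_of_mem_erase hg))
    rw [show E ^ 2 * L - L = (E ^ 2 - 1) * L by ring]
    refine Ideal.mul_mem_mul ?_ hLx
    rw [RingHom.mem_ker, map_sub, map_pow, hE, one_pow, map_one, sub_self]
  have hu3 : u ∈ invPointIdeal G x := by
    refine Ideal.subset_span ⟨?_, ?_⟩
    · rw [invariants_eq_fixedAlg]
      exact fun g => act_sum_act _ _ _
    · have := add_mem (Ideal.mul_le_left hu2) hLx
      rwa [sub_add_cancel] at this
  have := sub_mem (Ideal.mem_sup_left hu3) (Ideal.mem_sup_right (S := invPointIdeal G x) hu2)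
  rwa [sub_sub_cancel] at this

end Points

section Necessity

variable {n m : ℕ} {Wt G : Subgroup (Matrix.GeneralLinearGroup (Fin n) k)}
  {p : Fin m → MvPolynomial (Fin n) k} {d : Fin m → ℕ} {c : ↥Wt → Fin m → Fin m → k}

lemma eval_aeval (p : Fin m → MvPolynomial (Fin n) k) (x : Fin n → k)
    (f : MvPolynomial (Fin m) k) : eval x (aeval p f) = eval (pMap p x) f := by
  have h : (aeval (R := k) x).comp (aeval p) = aeval (R := k) (pMap p x) := by
    ext i
    simp [pMap, aeval_eq_eval]
  have := DFunLike.congr_fun h f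
  simpa only [AlgHom.comp_apply, aeval_eq_eval] using this

namespace QuotSetup

lemma eval_rep (hs : QuotSetup Wt G p d c) {x : Fin n → k} {s : ↥Wt}
    (hsx : Matrix.mulVec (s.1 : Matrix (Fin n) (Fin n) k) x = x) (f : MvPolynomial (Fin m) k) :
    eval (pMap p x) (hs.rep s f) = eval (pMap p x) f := by
  have hinv : Matrix.mulVec (↑((s.1)⁻¹) : Matrix (Fin n) (Fin n) k) x = x := by
    conv_lhs => rw [← hsx]
    rw [Matrix.mulVec_mulVec, ← Units.val_mul, inv_mul_cancel, Units.val_one, Matrix.one_mulVec]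
  rw [← eval_aeval, hs.aeval_rep, matRep_apply, eval_matAct, hinv, eval_aeval]

variable [CharZero k]

/-- At a point with trivial stabilizer, an invariant with vanishing differential comes, up to a
nonvanishing factor, from a function on `V` with vanishing differential. -/
lemma exists_lift_sq (hs : QuotSetup Wt G p d c) {x : Fin n → k}
    (hx : ∀ g ∈ G, Matrix.mulVec (g : Matrix (Fin n) (Fin n) k) x = x → g = 1)
    {f : MvPolynomial (Fin n) k} (hf : f ∈ invariants G) (hfx : f ∈ pointIdeal x * pointIdeal x) :
    ∃ q z : MvPolynomial (Fin m) k, eval (pMap p x) q ≠ 0 ∧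
      z ∈ pointIdeal (pMap p x) * pointIdeal (pMap p x) ∧ aeval p z = aeval p q * f := by
  classical
  have : Fintype ↥G := (hs.finite.subset hs.le).fintype
  obtain ⟨E, hE, hE'⟩ := exists_separating hx
  obtain ⟨r, hr, hrJ⟩ := Submodule.exists_sub_one_mem_and_smul_le_of_fg_of_le_sup
    (I := pointIdeal x) (N := invPointIdeal G x) (N' := pointIdeal x)
    (IsNoetherian.noetherian _) le_rfl (pointIdeal_le_sup hx)
  have hr1 : eval x r = 1 := by
    rw [RingHom.mem_ker, map_sub, map_one, sub_eq_zero] at hr; exact hr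
  have hrJ' : ∀ b ∈ pointIdeal x, r * b ∈ invPointIdeal G x := fun b hb =>
    hrJ (Submodule.smul_mem_pointwise_smul b r _ hb)
  have h1 : r ^ 2 * f ∈ invPointIdeal G x * invPointIdeal G x := by
    clear hf
    induction hfx using Submodule.mul_induction_on' with
    | mem_mul_mem a ha b hb =>
      have := Ideal.mul_mem_mul (hrJ' a ha) (hrJ' b hb)
      convert this using 1; ring
    | add a _ b _ ha hb => rw [mul_add]; exact add_mem ha hb
  have hlift : ∀ u ∈ invariants G, u ∈ pointIdeal x →
      ∃ v ∈ pointIdeal (pMap p x), aeval p v = u := by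
    intro u hu hux
    obtain ⟨v, rfl⟩ := hs.exists_aeval_eq hu
    exact ⟨v, by rw [RingHom.mem_ker, ← eval_aeval]; exact hux, rfl⟩
  have h2 : ∀ F ∈ invPointIdeal G x * invPointIdeal G x, ∀ e, ∃ z ∈ pointIdeal (pMap p x) *
      pointIdeal (pMap p x), aeval p z = avg (matRep G) (e * F) := by
    intro F hF
    rw [invPointIdeal, Ideal.span_mul_span'] at hF
    induction hF using Submodule.span_induction with
    | mem F hF =>
      obtain ⟨u, ⟨hu, hux⟩, v, ⟨hv, hvx⟩, rfl⟩ := hF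
      intro e
      obtain ⟨u', hu', hu''⟩ := hlift u hu hux
      obtain ⟨v', hv', hv''⟩ := hlift v hv hvx
      obtain ⟨e', he'⟩ := hs.exists_aeval_eq (f := avg (matRep G) e) (by
        rw [invariants_eq_fixedAlg]; exact avg_mem _ _)
      refine ⟨e' * (u' * v'), Ideal.mul_mem_left _ _ (Ideal.mul_mem_mul hu' hv'), ?_⟩
      have huv : u * v ∈ fixedAlg (matRep G) := by
        rw [← invariants_eq_fixedAlg]; exact mul_mem hu hv
      change _ = avg (matRep G) (e * (u * v))
      rw [avg_mul _ _ huv, map_mul, map_mul, he', hu'', hv'']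
    | zero => exact fun e => ⟨0, zero_mem _, by simp⟩
    | add a b _ _ ha hb =>
      intro e
      obtain ⟨z, hz, hz'⟩ := ha e
      obtain ⟨y, hy, hy'⟩ := hb e
      exact ⟨z + y, add_mem hz hy, by rw [map_add, mul_add, map_add, hz', hy']⟩
    | smul t a _ ha =>
      intro e
      obtain ⟨z, hz, hz'⟩ := ha (e * t)
      exact ⟨z, hz, by rw [hz', smul_eq_mul, mul_assoc]⟩
  obtain ⟨z, hz, hz'⟩ := h2 _ h1 E
  have hf' := hf
  rw [invariants_eq_fixedAlg] at hf'
  rw [← mul_assoc, avg_mul _ _ hf'] at hz'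
  obtain ⟨q, hq⟩ := hs.exists_aeval_eq (f := avg (matRep G) (E * r ^ 2)) (by
    rw [invariants_eq_fixedAlg]; exact avg_mem _ _)
  refine ⟨q, z, ?_, hz, by rw [hz', hq]⟩
  rw [← eval_aeval, hq, avg_apply, smul_eval, map_sum, ← Finset.add_sum_erase _ _
    (Finset.mem_univ 1), act_one, Finset.sum_eq_zero fun g hg => ?_, add_zero, map_mul, map_pow,
    hE, hr1, one_pow, mul_one, mul_one]
  · exact inv_ne_zero (by exact_mod_cast Fintype.card_ne_zero)
  · rw [map_mul, map_mul, matRep_apply, hE' g (Finset.ne_of_mem_erase hg), zero_mul]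

/-- Up to a factor nonvanishing at the origin, relations are generated by invariant relations. -/
lemma exists_mul_relIdeal_le (hs : QuotSetup Wt G p d c) (htriv : TrivialConormal Wt p c) :
    ∃ r : MvPolynomial (Fin m) k, constantCoeff r = 1 ∧ ∀ h ∈ relIdeal p,
      r * h ∈ Ideal.span {f | f ∈ relIdeal p ∧ f ∈ fixedAlg hs.rep} := by
  have : Fintype ↥Wt := hs.finite.fintype
  have hle : relIdeal p ≤ Ideal.span {f | f ∈ relIdeal p ∧ f ∈ fixedAlg hs.rep} ⊔
      idealPlus k m * relIdeal p := by
    intro f hf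
    have h1 : avg hs.rep f - f ∈ idealPlus k m * relIdeal p :=
      avg_sub_mem hs.rep fun w => htriv w f hf
    have h2 : avg hs.rep f ∈ Ideal.span {f | f ∈ relIdeal p ∧ f ∈ fixedAlg hs.rep} :=
      Ideal.subset_span ⟨avg_mem_submodule hs.rep (P := (relIdeal p).restrictScalars k)
        fun w => hs.rep_mem_relIdeal w f hf, avg_mem _ _⟩
    have := sub_mem (Ideal.mem_sup_left h2) (Ideal.mem_sup_right
      (S := Ideal.span {f | f ∈ relIdeal p ∧ f ∈ fixedAlg hs.rep}) h1)
    rwa [sub_sub_cancel] at this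
  obtain ⟨r, hr, hrI⟩ := Submodule.exists_sub_one_mem_and_smul_le_of_fg_of_le_sup
    (I := idealPlus k m) (N' := relIdeal p) (IsNoetherian.noetherian _) le_rfl hle
  refine ⟨r, ?_, fun h hh => hrI (Submodule.smul_mem_pointwise_smul h r _ hh)⟩
  have h0 : idealPlus k m ≤ RingHom.ker constantCoeff := by
    refine Ideal.span_le.2 ?_
    rintro _ ⟨i, rfl⟩
    simp
  have := h0 hr
  rwa [RingHom.mem_ker, map_sub, map_one, sub_eq_zero] at this

/-- If `G` is good, then at a generic point the kernel of the differential on the span of the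
generators is fixed by the stabilizer of the point. -/
lemma matAct_eq_of_mem_sq (hs : QuotSetup Wt G p d c)
    {r : MvPolynomial (Fin m) k} (hr : ∀ h ∈ relIdeal p,
      r * h ∈ Ideal.span {f | f ∈ relIdeal p ∧ f ∈ fixedAlg hs.rep}) {x : Fin n → k}
    (hrx : eval (pMap p x) r ≠ 0)
    (hx : ∀ g ∈ G, Matrix.mulVec (g : Matrix (Fin n) (Fin n) k) x = x → g = 1)
    {s : ↥Wt} (hsx : Matrix.mulVec (s.1 : Matrix (Fin n) (Fin n) k) x = x) (a : Fin m → k)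
    (ha : aeval p (linForm a) ∈ pointIdeal x * pointIdeal x) :
    matAct s.1 (aeval p (linForm a)) = aeval p (linForm a) := by
  set y := pMap p x with hy
  obtain ⟨q, z, hq, hz, hqz⟩ := hs.exists_lift_sq hx (hs.aeval_mem _) ha
  have hmap : ∀ f ∈ pointIdeal y * pointIdeal y, hs.rep s f ∈ pointIdeal y * pointIdeal y := by
    have : pointIdeal y * pointIdeal y ≤ (pointIdeal y * pointIdeal y).comap (hs.rep s) :=
      Ideal.mul_le.2 fun a ha b hb => by
        rw [Ideal.mem_comap, map_mul]
        refine Ideal.mul_mem_mul ?_ ?_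
        · rw [RingHom.mem_ker, hs.eval_rep hsx]; exact ha
        · rw [RingHom.mem_ker, hs.eval_rep hsx]; exact hb
    exact this
  have hIy : ∀ f ∈ relIdeal p, f ∈ pointIdeal y := by
    intro f hf
    rw [RingHom.mem_ker, hy, ← eval_aeval, show aeval p f = 0 from hf, map_zero]
  have hinv : ∀ f ∈ Ideal.span {f | f ∈ relIdeal p ∧ f ∈ fixedAlg hs.rep},
      hs.rep s f - f ∈ pointIdeal y * pointIdeal y := by
    intro f hf
    induction hf using Submodule.span_induction with
    | mem f hf => rw [hf.2 s, sub_self]; exact zero_mem _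
    | zero => simp
    | add a b _ _ ha hb => rw [map_add, add_sub_add_comm]; exact add_mem ha hb
    | smul t a haI ha =>
      have haI' : a ∈ pointIdeal y := by
        refine hIy a ?_
        exact (Ideal.span_le.2 fun f hf => hf.1 :
          Ideal.span {f | f ∈ relIdeal p ∧ f ∈ fixedAlg hs.rep} ≤ relIdeal p) haI
      rw [smul_eq_mul, map_mul, show hs.rep s t * hs.rep s a - t * a =
        hs.rep s t * (hs.rep s a - a) + (hs.rep s t - t) * a by ring]
      refine add_mem (Ideal.mul_mem_left _ _ ha) (Ideal.mul_mem_mul ?_ haI')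
      rw [RingHom.mem_ker, map_sub, hs.eval_rep hsx, sub_self]
  have hI : ∀ h ∈ relIdeal p, hs.rep s h - h ∈ pointIdeal y * pointIdeal y := by
    intro h hh
    have h1 := hinv _ (hr h hh)
    have h2 : (r - C (eval y r)) * h ∈ pointIdeal y * pointIdeal y :=
      Ideal.mul_mem_mul (sub_C_mem_pointIdeal y r) (hIy h hh)
    have h3 := sub_mem h1 (sub_mem (hmap _ h2) h2)
    have h4 : hs.rep s (r * h) - r * h - (hs.rep s ((r - C (eval y r)) * h) -
        (r - C (eval y r)) * h) = C (eval y r) * (hs.rep s h - h) := by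
      have : hs.rep s (C (eval y r)) = C (eval y r) := (hs.rep s).commutes _
      rw [map_mul, map_mul, map_sub, this]
      ring
    rw [h4] at h3
    have h5 := Ideal.mul_mem_left _ (C (eval y r)⁻¹) h3
    rwa [← mul_assoc, ← C_mul, inv_mul_cancel₀ hrx, C_1, one_mul] at h5
  have hLy : linForm a ∈ pointIdeal y := by
    rw [RingHom.mem_ker, hy, ← eval_aeval]
    exact Ideal.mul_le_left ha
  have h0 : C (eval y q) * linForm a - (z - (q - C (eval y q)) * linForm a) ∈ relIdeal p := by
    change aeval p _ = 0
    simp only [map_sub, map_mul, hqz]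
    ring
  have h1 := hI _ h0
  have h2 : z - (q - C (eval y q)) * linForm a ∈ pointIdeal y * pointIdeal y :=
    sub_mem hz (Ideal.mul_mem_mul (sub_C_mem_pointIdeal y q) hLy)
  have h3 := add_mem h1 (sub_mem (hmap _ h2) h2)
  have h4 : hs.rep s (C (eval y q)) = C (eval y q) := (hs.rep s).commutes _
  have h5 : C (eval y q) * (hs.rep s (linForm a) - linForm a) ∈
      pointIdeal y * pointIdeal y := by
    convert h3 using 1
    simp only [map_sub, map_mul, h4]
    ring
  have h6 := Ideal.mul_mem_left _ (C (eval y q)⁻¹) h5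
  rw [← mul_assoc, ← C_mul, inv_mul_cancel₀ hq, C_1, one_mul] at h6
  obtain ⟨b, hb⟩ : ∃ b, hs.rep s (linForm a) = linForm b := by
    refine exists_linForm ?_
    rw [linForm_apply, map_sum]
    refine (weightedHomogeneousSubmodule k 1 1).sum_mem fun i _ => ?_
    rw [map_smul, rep_apply, polyAct, aeval_X]
    exact Submodule.smul_mem _ _ (linForm_isHomogeneous _)
  rw [hb, ← map_sub] at h6
  have h7 := linForm_eq_zero_of_mem_sq h6
  rw [map_sub, sub_eq_zero, ← hb] at h7
  rw [← matRep_apply, ← hs.aeval_rep, h7]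

end QuotSetup

end Necessity

section Generic

variable {n m : ℕ} {Wt G : Subgroup (Matrix.GeneralLinearGroup (Fin n) k)}
  {p : Fin m → MvPolynomial (Fin n) k} {d : Fin m → ℕ} {c : ↥Wt → Fin m → Fin m → k}
  {α : Submodule k (Fin n → k) → MvPolynomial (Fin n) k}

/-- A nontrivial element of finite order fixing a hyperplane pointwise is a reflection. -/
lemma isReflection_of_fixes (hW : (Wt : Set (Matrix.GeneralLinearGroup (Fin n) k)).Finite)
    {g : Matrix.GeneralLinearGroup (Fin n) k} (hg : g ∈ Wt) (hg1 : g ≠ 1) {a : Fin n → k}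
    (ha : a ≠ 0)
    (h : ∀ x, a ⬝ᵥ x = 0 → Matrix.mulVec (g : Matrix (Fin n) (Fin n) k) x = x) :
    IsReflection (g : Matrix (Fin n) (Fin n) k) ∧ ∀ x, a ⬝ᵥ x = 0 ↔
      x ∈ LinearMap.ker (Matrix.toLin' (g : Matrix (Fin n) (Fin n) k) - LinearMap.id) := by
  have : Finite ↥Wt := hW.to_subtype
  set φ : (Fin n → k) →ₗ[k] k := dotProductBilin k k a with hφ
  have hφa : ∀ x, φ x = a ⬝ᵥ x := fun x => rfl
  have hφ0 : φ ≠ 0 := by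
    intro h0
    refine ha (funext fun i => ?_)
    have := LinearMap.congr_fun h0 (Pi.single i 1)
    simpa [hφa] using this
  set K := LinearMap.ker (Matrix.toLin' (g : Matrix (Fin n) (Fin n) k) - LinearMap.id) with hK
  have hle : LinearMap.ker φ ≤ K := by
    intro x hx
    simpa [hK, sub_eq_zero] using h x hx
  have hfr := Module.Dual.finrank_ker_add_one_of_ne_zero (f := φ) hφ0
  have hKtop : K ≠ ⊤ := by
    intro ht
    refine hg1 (Units.ext ?_)
    refine Matrix.toLin'.injective ?_
    ext1 i
    rw [← sub_eq_zero, ← LinearMap.sub_comp]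
    ext1
    have : LinearMap.single k (fun _ => k) i 1 ∈ K := ht ▸ Submodule.mem_top
    simpa [hK] using this
  have hlt := Submodule.finrank_lt hKtop
  rw [Module.finrank_fin_fun] at hlt
  change Module.finrank k (LinearMap.ker φ) + 1 = Module.finrank k (Fin n → k) at hfr
  rw [Module.finrank_fin_fun] at hfr
  have hle' := Submodule.finrank_mono hle
  have heq : LinearMap.ker φ = K := Submodule.eq_of_le_of_finrank_le hle (by omega)
  refine ⟨⟨?_, ?_⟩, fun x => ?_⟩
  · have h1 : IsOfFinOrder (⟨g, hg⟩ : ↥Wt) := isOfFinOrder_of_finite _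
    exact ((Units.coeHom _).comp Wt.subtype).isOfFinOrder h1
  · rw [← hK, ← heq, hfr]
  · rw [← heq]; rfl

lemma reflHyps_subset_reflHyps' (hnorefl : ∀ g ∈ G, ¬ IsReflection (g : Matrix (Fin n) (Fin n) k))
    {H : Submodule k (Fin n → k)} (hH : H ∈ reflHyps Wt) : H ∈ reflHyps' Wt G := by
  obtain ⟨g, hg, hgr, rfl⟩ := hH
  exact QuotSetup.ker_mem_reflHyps' (s := ⟨g, hg⟩) hnorefl hgr

/-- Invariance modulo a prime ideal is realized by a group element. -/
lemma exists_matAct_sub_mem [CharZero k] [Fintype ↥G] {P : Ideal (MvPolynomial (Fin n) k)}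
    [P.IsPrime] (s : Matrix.GeneralLinearGroup (Fin n) k)
    (h : ∀ f ∈ invariants G, matAct s f - f ∈ P) :
    ∃ g ∈ G, ∀ a : Fin n → k, matAct s (linForm a) - matAct g (linForm a) ∈ P := by
  classical
  let U : ↥G → Submodule k (Fin n → k) := fun g =>
    (P.restrictScalars k).comap (((matAct s).toLinearMap - (matAct g.1).toLinearMap) ∘ₗ linForm)
  have hU : ⋃ g, (U g : Set (Fin n → k)) = Set.univ := by
    refine Set.eq_univ_iff_forall.2 fun a => ?_
    set b := linForm a
    have hF : ∀ i, (∏ g : ↥G, (Polynomial.X - Polynomial.C (matRep G g b))).coeff i ∈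
        invariants G := by
      intro i g hg
      have h1 : (∏ g : ↥G, (Polynomial.X - Polynomial.C (matRep G g b))).map
          (matRep G ⟨g, hg⟩ : _ →+* _) =
          ∏ g : ↥G, (Polynomial.X - Polynomial.C (matRep G g b)) := by
        rw [Polynomial.map_prod]
        simp only [Polynomial.map_sub, Polynomial.map_X, Polynomial.map_C]
        refine Fintype.prod_equiv (Equiv.mulLeft ⟨g, hg⟩) _ _ fun γ => ?_
        rw [Equiv.coe_mulLeft, act_mul]
        rfl
      have := congrArg (Polynomial.coeff · i) h1
      rwa [Polynomial.coeff_map] at this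
    set F := ∏ g : ↥G, (Polynomial.X - Polynomial.C (matRep G g b)) with hFdef
    have hFb : F.eval b = 0 := by
      rw [hFdef, Polynomial.eval_prod]
      exact Finset.prod_eq_zero (Finset.mem_univ 1) (by simp)
    have hFs : F.eval (matAct s b) ∈ P := by
      have h1 : (F.map (matAct s : _ →+* _)).eval (matAct s b) = 0 := by
        have := Polynomial.eval_map_apply (f := (matAct s : _ →+* MvPolynomial (Fin n) k)) (p := F) b
        rw [hFb, map_zero] at this
        exact this
      have h2 : (F.map (matAct s : _ →+* _) - F).eval (matAct s b) ∈ P := by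
        rw [Polynomial.eval_eq_sum_range]
        refine sum_mem fun i _ => Ideal.mul_mem_right _ _ ?_
        rw [Polynomial.coeff_sub, Polynomial.coeff_map]
        exact h _ (hF i)
      rw [Polynomial.eval_sub, h1, zero_sub] at h2
      exact (neg_mem_iff).1 h2
    rw [hFdef, Polynomial.eval_prod, Ideal.IsPrime.prod_mem_iff] at hFs
    obtain ⟨g, -, hg⟩ := hFs
    refine Set.mem_iUnion.2 ⟨g, ?_⟩
    rwa [Polynomial.eval_sub, Polynomial.eval_X, Polynomial.eval_C] at hg
  obtain ⟨g, hg⟩ := Subspace.exists_eq_top_of_iUnion_eq_univ hU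
  refine ⟨g, g.2, fun a => ?_⟩
  have : a ∈ U g := hg ▸ Submodule.mem_top
  exact this

lemma eq_one_of_matAct_linForm {s : Matrix.GeneralLinearGroup (Fin n) k}
    (h : ∀ a : Fin n → k, matAct s (linForm a) = linForm a) : s = 1 := by
  rw [← inv_eq_one]
  refine Units.ext (Matrix.ext_of_mulVec_single fun i => ?_)
  refine dotProduct_eq _ _ fun a => ?_
  rw [dotProduct_comm, dotProduct_comm _ a, ← eval_linForm, ← eval_matAct, h, eval_linForm,
    Units.val_one, Matrix.one_mulVec]

variable [CharZero k]

namespace QuotSetup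

lemma exists_generic (hs : QuotSetup Wt G p d c)
    (hnorefl : ∀ g ∈ G, ¬ IsReflection (g : Matrix (Fin n) (Fin n) k)) (hα : IsDefining Wt α)
    {H : Submodule k (Fin n → k)} (hH : H ∈ reflHyps Wt) {r : MvPolynomial (Fin m) k}
    (hr : constantCoeff r = 1) :
    ∃ x ∈ H, (∀ g ∈ G, Matrix.mulVec (g : Matrix (Fin n) (Fin n) k) x = x → g = 1) ∧
      eval (pMap p x) r ≠ 0 := by
  obtain ⟨a, ha, -, haH⟩ := hα.exists_linForm hH
  have hG : Finite ↥G := (hs.finite.subset hs.le).to_subtype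
  obtain ⟨x, hxH, hx⟩ : ∃ x ∈ H, ∀ g ∈ G,
      Matrix.mulVec (g : Matrix (Fin n) (Fin n) k) x = x → g = 1 := by
    by_contra! hcon
    let U : {g : ↥G // g ≠ 1} → Submodule k H := fun g => (LinearMap.ker (Matrix.toLin'
      (g.1.1 : Matrix (Fin n) (Fin n) k) - LinearMap.id)).comap H.subtype
    have hU : ⋃ g, (U g : Set H) = Set.univ := by
      refine Set.eq_univ_iff_forall.2 fun x => ?_
      obtain ⟨g, hg, hgx, hg1⟩ := hcon x x.2
      refine Set.mem_iUnion.2 ⟨⟨⟨g, hg⟩, fun h => hg1 (congrArg Subtype.val h)⟩, ?_⟩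
      simp [U, hgx]
    obtain ⟨⟨⟨g, hg⟩, hg1⟩, hgU⟩ := Subspace.exists_eq_top_of_iUnion_eq_univ hU
    refine hnorefl g hg (isReflection_of_fixes hs.finite (hs.le hg)
      (fun h => hg1 (Subtype.ext h)) ha fun x hx => ?_).1
    have : (⟨x, (haH x).1 hx⟩ : H) ∈ U ⟨⟨g, hg⟩, hg1⟩ := hgU ▸ Submodule.mem_top
    simpa [U, sub_eq_zero] using this
  set Q : Polynomial k := aeval (fun i => Polynomial.C (x i) * Polynomial.X) (aeval p r) with hQ
  have hQe : ∀ t, Q.eval t = eval (pMap p (t • x)) r := by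
    intro t
    have h : (Polynomial.aeval t).comp (aeval fun i => Polynomial.C (x i) * Polynomial.X) =
        (aeval (R := k) (t • x)) := by
      ext i
      rw [AlgHom.comp_apply, aeval_X, aeval_X, map_mul, Polynomial.aeval_C, Polynomial.aeval_X]
      exact mul_comm _ _
    have := DFunLike.congr_fun h (aeval p r)
    rw [AlgHom.comp_apply, ← hQ, Polynomial.coe_aeval_eq_eval, aeval_eq_eval, eval_aeval] at this
    exact this
  have hQ0 : Q ≠ 0 := by
    intro h0
    have h1 := hQe 0
    have h2 : pMap p (0 : Fin n → k) = 0 := by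
      funext i
      rw [pMap, ← constantCoeff_eq_eval, hs.constantCoeff_p]
      rfl
    rw [h0, Polynomial.eval_zero, zero_smul, h2, ← constantCoeff_eq_eval, hr] at h1
    exact zero_ne_one h1
  obtain ⟨t, ht⟩ : ∃ t, (Q * Polynomial.X).eval t ≠ 0 := by
    by_contra! h
    exact mul_ne_zero hQ0 Polynomial.X_ne_zero (Polynomial.funext fun t => by simpa using h t)
  rw [Polynomial.eval_mul, Polynomial.eval_X, mul_ne_zero_iff, hQe] at ht
  refine ⟨t • x, H.smul_mem t hxH, fun g hg hgx => hx g hg ?_, ht.1⟩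
  rw [Matrix.mulVec_smul] at hgx
  exact smul_right_injective _ ht.2 hgx

/-- An element acting trivially on the invariants of `G` belongs to `G`. -/
lemma mem_of_fix (hs : QuotSetup Wt G p d c) {s : Matrix.GeneralLinearGroup (Fin n) k}
    (h : ∀ i, matAct s (p i) = p i) : s ∈ G := by
  have : Fintype ↥G := (hs.finite.subset hs.le).fintype
  obtain ⟨g, hg, hsg⟩ := exists_matAct_sub_mem (G := G) (P := ⊥) s fun f hf => by
    obtain ⟨q, rfl⟩ := hs.exists_aeval_eq hf
    have : (matAct s).comp (aeval p) = aeval p := by ext i : 1; simp [h]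
    rw [← AlgHom.comp_apply, this, sub_self]
    exact zero_mem _
  have h1 : g⁻¹ * s = 1 := eq_one_of_matAct_linForm fun a => by
    have h2 := sub_eq_zero.1 (Ideal.mem_bot.1 (hsg a))
    rw [matAct_mul, AlgHom.comp_apply, h2, matAct_inv_cancel']
  rw [← inv_mul_eq_one.1 h1]
  exact hg

end QuotSetup

end Generic

section RootForms

variable {n m : ℕ} {Wt G : Subgroup (Matrix.GeneralLinearGroup (Fin n) k)}
  {p : Fin m → MvPolynomial (Fin n) k} {d : Fin m → ℕ} {c : ↥Wt → Fin m → Fin m → k}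
  {α : Submodule k (Fin n → k) → MvPolynomial (Fin n) k}

/-- The stabilizer of `H` moves the generators by multiples of a single invariant `ℓ`, which
vanishes to order one on `H`. -/
structure IsRootForm (Wt G : Subgroup (Matrix.GeneralLinearGroup (Fin n) k))
    (p : Fin m → MvPolynomial (Fin n) k) (α : Submodule k (Fin n → k) → MvPolynomial (Fin n) k)
    (H : Submodule k (Fin n → k)) (ℓ : MvPolynomial (Fin n) k) : Prop where
  mem : ℓ ∈ invariants G
  ne_zero : ℓ ≠ 0
  dvd : α H ∣ ℓ
  not_sq_dvd : ¬ α H * α H ∣ ℓ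
  moves : ∀ s ∈ Wt ⊓ pointStab H, ∀ i, ∃ t : k, matAct s (p i) - p i = t • ℓ

lemma mem_pointStab_of_dvd {a : Fin n → k} {s : Matrix.GeneralLinearGroup (Fin n) k}
    (h : ∀ b : Fin n → k, linForm a ∣ matAct s (linForm b) - linForm b) {x : Fin n → k}
    (hx : a ⬝ᵥ x = 0) : Matrix.mulVec (s : Matrix (Fin n) (Fin n) k) x = x := by
  have h1 : Matrix.mulVec (↑(s⁻¹) : Matrix (Fin n) (Fin n) k) x = x := by
    refine dotProduct_eq _ _ fun b => ?_
    obtain ⟨q, hq⟩ := h b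
    have := congrArg (eval x) hq
    rw [map_mul, eval_linForm, hx, zero_mul, map_sub, eval_matAct, eval_linForm, eval_linForm,
      sub_eq_zero] at this
    rwa [dotProduct_comm, dotProduct_comm x]
  conv_lhs => rw [← h1]
  rw [Matrix.mulVec_mulVec, ← Units.val_mul, mul_inv_cancel, Units.val_one, Matrix.one_mulVec]

namespace IsRootForm

variable {H H' : Submodule k (Fin n → k)} {ℓ ℓ' r : MvPolynomial (Fin n) k}

lemma dvd_sub (h : IsRootForm Wt G p α H ℓ) (hs : QuotSetup Wt G p d c)
    {s : Matrix.GeneralLinearGroup (Fin n) k} (hsH : s ∈ Wt ⊓ pointStab H)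
    {f : MvPolynomial (Fin n) k} (hf : f ∈ invariants G) : ℓ ∣ matAct s f - f := by
  obtain ⟨q, rfl⟩ := hs.exists_aeval_eq hf
  have h1 : (Ideal.Quotient.mkₐ k (Ideal.span {ℓ})).comp ((matAct s).comp (aeval p)) =
      (Ideal.Quotient.mkₐ k (Ideal.span {ℓ})).comp (aeval p) := by
    ext i
    simp only [AlgHom.comp_apply, aeval_X]
    refine (Ideal.Quotient.mk_eq_mk_iff_sub_mem _ _).2 ?_
    obtain ⟨t, ht⟩ := h.moves s hsH i
    rw [ht]
    exact Submodule.smul_of_tower_mem _ t (Ideal.mem_span_singleton_self ℓ)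
  rw [← Ideal.mem_span_singleton]
  exact (Ideal.Quotient.mk_eq_mk_iff_sub_mem _ _).1 (DFunLike.congr_fun h1 q)

lemma matAct_mul_inv {s g : Matrix.GeneralLinearGroup (Fin n) k} (hg : g ∈ G) :
    ∀ f ∈ invariants G, matAct s f = matAct (s * g⁻¹) f := by
  intro f hf
  rw [matAct_mul, AlgHom.comp_apply, hf _ (inv_mem hg)]

variable [CharZero k]

lemma exists_eq_smul (h : IsRootForm Wt G p α H ℓ) (h' : IsRootForm Wt G p α H' ℓ')
    (hs : QuotSetup Wt G p d c) {s t : Matrix.GeneralLinearGroup (Fin n) k}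
    (hsH : s ∈ Wt ⊓ pointStab H) (htH : t ∈ Wt ⊓ pointStab H') (hsG : s ∉ G)
    (hst : ∀ f ∈ invariants G, matAct s f = matAct t f) : ∃ b : k, b ≠ 0 ∧ ℓ' = b • ℓ := by
  obtain ⟨i, hi⟩ : ∃ i, matAct s (p i) ≠ p i := by
    by_contra! hcon
    exact hsG (hs.mem_of_fix hcon)
  obtain ⟨a, ha⟩ := h.moves s hsH i
  obtain ⟨b, hb⟩ := h'.moves t htH i
  have hne := sub_ne_zero.2 hi
  rw [hst _ (hs.p_mem i)] at ha hne
  have ha0 : a ≠ 0 := by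
    rintro rfl
    exact hne (by rw [ha, zero_smul])
  have hb0 : b ≠ 0 := by
    rintro rfl
    exact hne (by rw [hb, zero_smul])
  refine ⟨b⁻¹ * a, mul_ne_zero (inv_ne_zero hb0) ha0, ?_⟩
  rw [mul_smul, ← ha, hb, inv_smul_smul₀ hb0]

lemma exists_dvd_linForm (h : IsRootForm Wt G p α H ℓ) (hs : QuotSetup Wt G p d c)
    (hr : Prime r) (hrℓ : r ∣ ℓ) {s : Matrix.GeneralLinearGroup (Fin n) k}
    (hsH : s ∈ Wt ⊓ pointStab H) :
    ∃ g ∈ G, ∀ b : Fin n → k, r ∣ matAct (s * g⁻¹) (linForm b) - linForm b := by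
  have : Fintype ↥G := (hs.finite.subset hs.le).fintype
  have : (Ideal.span {r}).IsPrime := (Ideal.span_singleton_prime hr.ne_zero).2 hr
  obtain ⟨g, hg, hsg⟩ := exists_matAct_sub_mem (G := G) (P := Ideal.span {r}) s fun f hf =>
    Ideal.mem_span_singleton.2 (hrℓ.trans (h.dvd_sub hs hsH hf))
  refine ⟨g, hg, fun b => ?_⟩
  obtain ⟨b', hb'⟩ := ReflQuot.exists_linForm (matAct_isHomogeneous g⁻¹ (linForm_isHomogeneous b))
  have := Ideal.mem_span_singleton.1 (hsg b')
  rwa [← hb', matAct_inv_cancel, ← AlgHom.comp_apply, ← matAct_mul] at this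

lemma exists_mul_inv_mem (h : IsRootForm Wt G p α H ℓ) (hs : QuotSetup Wt G p d c)
    (hα : IsDefining Wt α) (hH' : H' ∈ reflHyps Wt) (hdvd : α H' ∣ ℓ)
    {s : Matrix.GeneralLinearGroup (Fin n) k} (hsH : s ∈ Wt ⊓ pointStab H) :
    ∃ g ∈ G, s * g⁻¹ ∈ Wt ⊓ pointStab H' := by
  obtain ⟨g, hg, hsg⟩ := h.exists_dvd_linForm hs (hα.prime hH') hdvd hsH
  obtain ⟨a, -, ha, haH⟩ := hα.exists_linForm hH'
  rw [ha] at hsg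
  exact ⟨g, hg, Wt.mul_mem hsH.1 (Wt.inv_mem (hs.le hg)), fun x hx =>
    mem_pointStab_of_dvd hsg ((haH x).2 hx)⟩

lemma subset_of_dvd (h : IsRootForm Wt G p α H ℓ) (hs : QuotSetup Wt G p d c)
    (hα : IsDefining Wt α) (hH' : H' ∈ reflHyps Wt) (hdvd : α H' ∣ ℓ) :
    {x | ∃ g ∈ G, ∃ u ∈ Wt ⊓ pointStab H, x = g * u} ⊆
      {x | ∃ g ∈ G, ∃ u ∈ Wt ⊓ pointStab H', x = g * u} := by
  rintro x ⟨g, hg, u, hu, rfl⟩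
  obtain ⟨g', hg', hu'⟩ := h.exists_mul_inv_mem hs hα hH' hdvd hu
  refine ⟨g * ((u * g'⁻¹) * g' * (u * g'⁻¹)⁻¹), mul_mem hg (hs.normal _ hu'.1 _ hg'), _, hu', ?_⟩
  group

/-- Prime divisors of the root form define hyperplanes in the class of `H`. -/
lemma exists_associated (h : IsRootForm Wt G p α H ℓ) (hs : QuotSetup Wt G p d c)
    (hα : IsDefining Wt α)
    (hex : ∀ H' ∈ reflHyps' Wt G, ∃ ℓ', IsRootForm Wt G p α H' ℓ') (hH : H ∈ reflHyps' Wt G)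
    (hr : Prime r) (hrℓ : r ∣ ℓ) :
    ∃ H' ∈ reflHyps' Wt G, imageEq Wt G H H' ∧ Associated r (α H') := by
  obtain ⟨s, hsH, hsG⟩ := SetLike.not_le_iff_exists.1 hH.2
  obtain ⟨g, hg, hsg⟩ := h.exists_dvd_linForm hs hr hrℓ hsH
  set t := s * g⁻¹ with ht
  have htG : t ∉ G := fun h => hsG (by
    have := mul_mem h hg
    rwa [ht, inv_mul_cancel_right] at this)
  have htW : t ∈ Wt := Wt.mul_mem hsH.1 (Wt.inv_mem (hs.le hg))
  have ht1 : t ≠ 1 := fun h => htG (h ▸ one_mem G)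
  obtain ⟨b, hb⟩ : ∃ b : Fin n → k, matAct t (linForm b) ≠ linForm b := by
    by_contra! hcon
    exact ht1 (eq_one_of_matAct_linForm hcon)
  obtain ⟨a, ha⟩ : ∃ a, matAct t (linForm b) - linForm b = linForm a :=
    ReflQuot.exists_linForm ((homogeneousSubmodule (Fin n) k 1).sub_mem
      (matAct_isHomogeneous t (linForm_isHomogeneous b)) (linForm_isHomogeneous b))
  have ha0 : a ≠ 0 := by
    rintro rfl
    rw [map_zero, sub_eq_zero] at ha
    exact hb ha
  have hra : Associated r (linForm a) := by
    have := hsg b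
    rw [ha] at this
    exact (hr.dvd_prime_iff_associated (linForm_prime ha0)).1 this
  have hfix : ∀ x, a ⬝ᵥ x = 0 → Matrix.mulVec (t : Matrix (Fin n) (Fin n) k) x = x := fun x hx =>
    mem_pointStab_of_dvd (fun b => hra.dvd_iff_dvd_left.1 (hsg b)) hx
  obtain ⟨htr, hker⟩ := isReflection_of_fixes hs.finite htW ht1 ha0 hfix
  set H' := LinearMap.ker (Matrix.toLin' (t : Matrix (Fin n) (Fin n) k) - LinearMap.id) with hH'
  have hH'r : H' ∈ reflHyps Wt := ⟨t, htW, htr, rfl⟩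
  have htH' : t ∈ Wt ⊓ pointStab H' := ⟨htW, mem_pointStab_ker t⟩
  have hH'' : H' ∈ reflHyps' Wt G := ⟨hH'r, fun h => htG (h htH')⟩
  obtain ⟨u, hu⟩ := exists_eq_smul_of_eval (hα H' hH'r).1 (linForm_isHomogeneous a) fun x hx => by
    rw [eval_linForm, hker]
    exact ((hα H' hH'r).2 x).1 hx
  have hassoc : Associated r (α H') := by
    refine hra.trans ?_
    refine ((hα.prime hH'r).dvd_prime_iff_associated (linForm_prime ha0)).1 ?_ |>.symm
    rw [hu, smul_eq_C_mul]
    exact dvd_mul_left _ _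
  obtain ⟨ℓ', h'⟩ := hex H' hH''
  obtain ⟨e, he, rfl⟩ := h.exists_eq_smul h' hs hsH htH' hsG (matAct_mul_inv hg)
  refine ⟨H', hH'', Set.Subset.antisymm ?_ ?_, hassoc⟩
  · exact h.subset_of_dvd hs hα hH'r (hassoc.dvd_iff_dvd_left.1 hrℓ)
  · refine h'.subset_of_dvd hs hα hH.1 ?_
    rw [smul_eq_C_mul]
    exact h.dvd.mul_left _

/-- Root forms of equivalent hyperplanes are proportional. -/
lemma exists_eq_smul_of_imageEq (h : IsRootForm Wt G p α H ℓ) (h' : IsRootForm Wt G p α H' ℓ')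
    (hs : QuotSetup Wt G p d c) (hH : H ∈ reflHyps' Wt G) (himg : imageEq Wt G H H') :
    ∃ b : k, b ≠ 0 ∧ ℓ' = b • ℓ := by
  obtain ⟨s, hsH, hsG⟩ := SetLike.not_le_iff_exists.1 hH.2
  have hmem : s ∈ {x | ∃ g ∈ G, ∃ u ∈ Wt ⊓ pointStab H, x = g * u} :=
    ⟨1, one_mem G, s, hsH, (one_mul s).symm⟩
  rw [himg] at hmem
  obtain ⟨g, hg, u, hu, rfl⟩ := hmem
  refine h.exists_eq_smul h' hs hsH hu hsG fun f hf => ?_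
  rw [matAct_mul, AlgHom.comp_apply, matAct_mem_invariants hs.normal hu.1 hf g hg]

lemma classProd_mem (h : IsRootForm Wt G p α H ℓ) (hs : QuotSetup Wt G p d c)
    (hα : IsDefining Wt α)
    (hex : ∀ H' ∈ reflHyps' Wt G, ∃ ℓ', IsRootForm Wt G p α H' ℓ') (hH : H ∈ reflHyps' Wt G) :
    classProd Wt G α H ∈ invariants G := by
  obtain ⟨u, hu⟩ : classProd Wt G α H ∣ ℓ := by
    refine hα.classProd_dvd hs.finite H fun H' hH' himg => ?_
    obtain ⟨ℓ', h'⟩ := hex H' hH'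
    obtain ⟨b, hb, rfl⟩ := h.exists_eq_smul_of_imageEq h' hs hH himg
    have := h'.dvd
    rwa [smul_eq_C_mul, IsUnit.dvd_mul_left ((isUnit_iff_ne_zero.2 hb).map C)] at this
  have hunit : IsUnit u := by
    by_contra hnu
    have hu0 : u ≠ 0 := by
      rintro rfl
      exact h.ne_zero (by rw [hu, mul_zero])
    obtain ⟨r, hr, hru⟩ := WfDvdMonoid.exists_irreducible_factor hnu hu0
    obtain ⟨H', hH', himg, hass⟩ := h.exists_associated hs hα hex hH hr.prime
      (hu ▸ hru.mul_left _)
    obtain ⟨ℓ', h'⟩ := hex H' hH'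
    obtain ⟨b, hb, rfl⟩ := h.exists_eq_smul_of_imageEq h' hs hH himg
    refine h'.not_sq_dvd ?_
    rw [smul_eq_C_mul]
    refine Dvd.dvd.mul_left ?_ _
    rw [hu]
    exact mul_dvd_mul (dvd_classProd hs.finite hH' himg) (hass.dvd_iff_dvd_left.1 hru)
  obtain ⟨a, ha, rfl⟩ := MvPolynomial.isUnit_iff_eq_C_of_isReduced.1 hunit
  have ha0 : a ≠ 0 := ha.ne_zero
  have : classProd Wt G α H = C a⁻¹ * ℓ := by
    rw [hu, mul_comm (classProd _ _ _ _), ← mul_assoc, ← C_mul, inv_mul_cancel₀ ha0, C_1, one_mul]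
  rw [this]
  exact mul_mem (Subalgebra.algebraMap_mem _ _) h.mem

end IsRootForm

namespace QuotSetup

variable [CharZero k]

/-- If `G` is good, then root forms exist. -/
lemma exists_isRootForm (hs : QuotSetup Wt G p d c)
    (hnorefl : ∀ g ∈ G, ¬ IsReflection (g : Matrix (Fin n) (Fin n) k)) (hα : IsDefining Wt α)
    (htriv : TrivialConormal Wt p c) {H : Submodule k (Fin n → k)} (hH : H ∈ reflHyps' Wt G) :
    ∃ ℓ, IsRootForm Wt G p α H ℓ := by
  obtain ⟨r, hr, hrI⟩ := hs.exists_mul_relIdeal_le htriv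
  obtain ⟨x, hxH, hx, hrx⟩ := hs.exists_generic hnorefl hα hH.1 hr
  have hαx : α H ∈ pointIdeal x := ((hα H hH.1).2 x).2 hxH
  have hfin : Finite ↥(Wt ⊓ pointStab H) :=
    (hs.finite.subset (inf_le_left : Wt ⊓ pointStab H ≤ Wt)).to_subtype
  have : Fintype ↥(Wt ⊓ pointStab H) := Fintype.ofFinite _
  let D : Submodule k (MvPolynomial (Fin n) k) :=
    (LinearMap.range ((aeval p).toLinearMap ∘ₗ linForm)) ⊓
      LinearMap.ker (avg (matRep (Wt ⊓ pointStab H)))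
  have hD : ∀ v ∈ D, v ∈ pointIdeal x * pointIdeal x → v = 0 := by
    rintro v ⟨⟨a, rfl⟩, hv⟩ hvx
    have h1 : aeval p (linForm a) ∈ fixedAlg (matRep (Wt ⊓ pointStab H)) := fun s =>
      hs.matAct_eq_of_mem_sq hrI hrx hx (s := ⟨s.1, s.2.1⟩) (s.2.2 x hxH) a hvx
    exact (avg_of_mem _ h1).symm.trans hv
  have hmove : ∀ s ∈ Wt ⊓ pointStab H, ∀ i, matAct s (p i) - p i ∈ D := by
    intro s hsH i
    refine ⟨⟨fun j => c ⟨s, hsH.1⟩ i j - if i = j then 1 else 0, ?_⟩, ?_⟩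
    · have := hs.equivar ⟨s, hsH.1⟩ i
      simp [linForm_apply, this, sub_smul, Finset.sum_sub_distrib]
    · change avg _ (_ - _) = 0
      rw [map_sub, sub_eq_zero]
      exact avg_act (matRep (Wt ⊓ pointStab H)) ⟨s, hsH⟩ (p i)
  obtain ⟨s, hsH, hsG⟩ := SetLike.not_le_iff_exists.1 hH.2
  obtain ⟨i, hi⟩ : ∃ i, matAct s (p i) ≠ p i := by
    by_contra! hcon
    exact hsG (hs.mem_of_fix hcon)
  set ℓ := matAct s (p i) - p i with hℓ
  have hℓ0 : ℓ ≠ 0 := sub_ne_zero.2 hi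
  obtain ⟨q, hq⟩ := hα.dvd_sub hH.1 hsH.2 (p i)
  rw [← hℓ] at hq
  have hqx : eval x q ≠ 0 := fun h => hℓ0 (hD ℓ (hmove s hsH i) (by
    rw [hq]; exact Ideal.mul_mem_mul hαx h))
  refine ⟨ℓ, sub_mem (matAct_mem_invariants hs.normal hsH.1 (hs.p_mem i)) (hs.p_mem i), hℓ0,
    ⟨q, hq⟩, ?_, fun t htH j => ?_⟩
  · rintro ⟨e, he⟩
    rw [hq, mul_assoc] at he
    have h1 := mul_left_cancel₀ (hα.prime hH.1).ne_zero he
    refine hqx ?_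
    rw [h1, map_mul, show eval x (α H) = 0 from hαx, zero_mul]
  · obtain ⟨q', hq'⟩ := hα.dvd_sub hH.1 htH.2 (p j)
    have h1 := hD (eval x q • (matAct t (p j) - p j) - eval x q' • ℓ)
      (sub_mem (D.smul_mem _ (hmove t htH j)) (D.smul_mem _ (hmove s hsH i))) (by
        rw [hq, hq', smul_eq_C_mul, smul_eq_C_mul, show C (eval x q) * (α H * q') -
          C (eval x q') * (α H * q) = α H * (C (eval x q) * q' - C (eval x q') * q) by ring]
        refine Ideal.mul_mem_mul hαx ?_
        rw [RingHom.mem_ker, map_sub, map_mul, map_mul, eval_C, eval_C, mul_comm, sub_self])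
    refine ⟨(eval x q)⁻¹ * eval x q', ?_⟩
    rw [mul_smul, ← sub_eq_zero.1 h1, inv_smul_smul₀ hqx]

/-- Necessity: class products are invariant. -/
theorem classProd_mem (hs : QuotSetup Wt G p d c)
    (hnorefl : ∀ g ∈ G, ¬ IsReflection (g : Matrix (Fin n) (Fin n) k)) (hα : IsDefining Wt α)
    (htriv : TrivialConormal Wt p c) {H : Submodule k (Fin n → k)} (hH : H ∈ reflHyps' Wt G) :
    classProd Wt G α H ∈ invariants G := by
  obtain ⟨ℓ, h⟩ := hs.exists_isRootForm hnorefl hα htriv hH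
  exact h.classProd_mem hs hα (fun H' hH' => hs.exists_isRootForm hnorefl hα htriv hH') hH

end QuotSetup

end RootForms

section Discriminant

variable {n m : ℕ} {Wt G : Subgroup (Matrix.GeneralLinearGroup (Fin n) k)}
  {p : Fin m → MvPolynomial (Fin n) k} {d : Fin m → ℕ} {c : ↥Wt → Fin m → Fin m → k}
  {α : Submodule k (Fin n → k) → MvPolynomial (Fin n) k}

/-- The eigenvalue of a reflection on its root form is the determinant of its inverse. -/
lemma matAct_linForm_eq_det {s : Matrix.GeneralLinearGroup (Fin n) k} {a : Fin n → k}
    (h : ∀ x, a ⬝ᵥ x = 0 → Matrix.mulVec (s : Matrix (Fin n) (Fin n) k) x = x) :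
    matAct s (linForm a) = (↑(s⁻¹) : Matrix (Fin n) (Fin n) k).det • linForm a := by
  obtain ⟨b, hb⟩ := exists_matAct_X (s := s) (linForm_isHomogeneous a) fun x hx =>
    h x (by rwa [eval_linForm] at hx)
  have hM : (↑(s⁻¹) : Matrix (Fin n) (Fin n) k) = 1 + Matrix.vecMulVec b a := by
    ext i j
    have h1 : matAct s (X i) = linForm fun j => (↑(s⁻¹) : Matrix (Fin n) (Fin n) k) i j := by
      simp [linForm_apply, matAct]
    have h2 : (X i : MvPolynomial (Fin n) k) = linForm (Pi.single i 1) := by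
      simp [linForm_apply, Pi.single_apply]
    have h3 := hb i
    rw [h1, h2, ← map_smul, ← map_add] at h3
    rw [congrFun (linForm_injective h3) j]
    simp [Matrix.vecMulVec_apply, Matrix.one_apply, Pi.single_apply, eq_comm]
  have hdet : (↑(s⁻¹) : Matrix (Fin n) (Fin n) k).det = 1 + a ⬝ᵥ b := by
    rw [hM, Matrix.vecMulVec_eq Unit, Matrix.det_one_add_replicateCol_mul_replicateRow]
  rw [hdet, add_smul, one_smul, linForm_apply, map_sum]
  simp_rw [map_smul, hb, smul_add, Finset.sum_add_distrib, smul_smul, ← Finset.sum_smul]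
  rfl

/-- The product of the defining forms of all reflecting hyperplanes. -/
def hypProd (Wt : Subgroup (Matrix.GeneralLinearGroup (Fin n) k))
    (α : Submodule k (Fin n → k) → MvPolynomial (Fin n) k) : MvPolynomial (Fin n) k :=
  ∏ᶠ H ∈ reflHyps Wt, α H

lemma hypProd_eq (hW : (Wt : Set (Matrix.GeneralLinearGroup (Fin n) k)).Finite) :
    hypProd Wt α = ∏ H ∈ (reflHyps_finite hW).toFinset, α H :=
  finprod_mem_eq_finite_toFinset_prod _ _

namespace IsDefining

lemma hypProd_ne_zero (hα : IsDefining Wt α)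
    (hW : (Wt : Set (Matrix.GeneralLinearGroup (Fin n) k)).Finite) : hypProd Wt α ≠ 0 := by
  rw [hypProd_eq hW, Finset.prod_ne_zero_iff]
  intro H hH
  exact (hα.prime ((reflHyps_finite hW).mem_toFinset.1 hH)).ne_zero

lemma hypProd_isHomogeneous (hα : IsDefining Wt α)
    (hW : (Wt : Set (Matrix.GeneralLinearGroup (Fin n) k)).Finite) :
    (hypProd Wt α).IsHomogeneous (∑ _H ∈ (reflHyps_finite hW).toFinset, 1) := by
  rw [hypProd_eq hW]
  exact IsHomogeneous.prod _ _ _ fun H hH => (hα H ((reflHyps_finite hW).mem_toFinset.1 hH)).1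

lemma hypProd_dvd_matAct (hα : IsDefining Wt α)
    (hW : (Wt : Set (Matrix.GeneralLinearGroup (Fin n) k)).Finite)
    {w : Matrix.GeneralLinearGroup (Fin n) k} (hw : w ∈ Wt) :
    hypProd Wt α ∣ matAct w (hypProd Wt α) := by
  conv_lhs => rw [hypProd_eq hW]
  refine Finset.prod_dvd_of_isRelPrime (fun H₁ h₁ H₂ h₂ hne => ?_) fun H hH => ?_
  · rw [Set.Finite.coe_toFinset] at h₁ h₂
    exact hα.isRelPrime h₁ h₂ hne
  rw [Set.Finite.mem_toFinset] at hH
  obtain ⟨a, ha0, ha, haH⟩ := hα.exists_linForm hH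
  obtain ⟨t, htW, htr, rfl⟩ := hH
  obtain ⟨a', ha'⟩ := ReflQuot.exists_linForm (matAct_isHomogeneous w⁻¹ (linForm_isHomogeneous a))
  have haa' : matAct w (linForm a') = linForm a := by rw [← ha', matAct_inv_cancel]
  have ha'0 : a' ≠ 0 := by
    rintro rfl
    rw [map_zero, map_zero] at haa'
    exact linForm_ne_zero ha0 haa'.symm
  have hdot : ∀ x, a' ⬝ᵥ x = a ⬝ᵥ Matrix.mulVec (w : Matrix (Fin n) (Fin n) k) x := by
    intro x
    rw [← eval_linForm, ← ha', eval_matAct, eval_linForm, inv_inv]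
  have ht1 : t ≠ 1 := by
    rintro rfl
    exact reflHyps_ne_top (Wt := Wt) ⟨1, htW, htr, rfl⟩ (by simp)
  have huW : w⁻¹ * t * w ∈ Wt := Wt.mul_mem (Wt.mul_mem (Wt.inv_mem hw) htW) hw
  have hu1 : w⁻¹ * t * w ≠ 1 := by
    intro h
    refine ht1 ?_
    have : t = w * (w⁻¹ * t * w) * w⁻¹ := by group
    rw [this, h, mul_one, mul_inv_cancel]
  obtain ⟨hur, hker⟩ := isReflection_of_fixes hW huW hu1 ha'0 fun x hx => by
    rw [hdot] at hx
    rw [Units.val_mul, Units.val_mul, ← Matrix.mulVec_mulVec, ← Matrix.mulVec_mulVec,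
      mem_pointStab_ker t _ ((haH _).1 hx), Matrix.mulVec_mulVec, ← Units.val_mul,
      inv_mul_cancel, Units.val_one, Matrix.one_mulVec]
  have hH' : _ ∈ reflHyps Wt := ⟨_, huW, hur, rfl⟩
  obtain ⟨u, hu⟩ := exists_eq_smul_of_eval (linForm_isHomogeneous a') (hα _ hH').1 fun x hx =>
    ((hα _ hH').2 x).2 ((hker x).1 (by rwa [eval_linForm] at hx))
  have hdvd := Finset.dvd_prod_of_mem α ((reflHyps_finite hW).mem_toFinset.2 hH')
  rw [← hypProd_eq hW] at hdvd
  refine dvd_trans ?_ (map_dvd (matAct w) hdvd)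
  rw [ha, hu, map_smul, haa', smul_eq_C_mul]
  exact dvd_mul_left _ _

lemma exists_matAct_hypProd (hα : IsDefining Wt α)
    (hW : (Wt : Set (Matrix.GeneralLinearGroup (Fin n) k)).Finite)
    {w : Matrix.GeneralLinearGroup (Fin n) k} (hw : w ∈ Wt) :
    ∃ χ : k, matAct w (hypProd Wt α) = χ • hypProd Wt α := by
  obtain ⟨q, hq⟩ := hα.hypProd_dvd_matAct hW hw
  have h0 := hα.hypProd_ne_zero hW
  have h1 : matAct w (hypProd Wt α) ≠ 0 := fun h => h0 (by
    rw [← matAct_inv_cancel' w (hypProd Wt α), h, map_zero])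
  have hd := (matAct_isHomogeneous w (hα.hypProd_isHomogeneous hW)).totalDegree h1
  have hq0 : q ≠ 0 := by
    rintro rfl
    exact h1 (by rw [hq, mul_zero])
  rw [hq, totalDegree_mul_of_isDomain h0 hq0, (hα.hypProd_isHomogeneous hW).totalDegree h0] at hd
  refine ⟨coeff 0 q, ?_⟩
  rw [hq, smul_eq_C_mul, ← totalDegree_eq_zero_iff_eq_C.1 (by omega), mul_comm]

lemma matAct_hypProd_of_isReflection (hα : IsDefining Wt α)
    (hW : (Wt : Set (Matrix.GeneralLinearGroup (Fin n) k)).Finite)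
    {s : Matrix.GeneralLinearGroup (Fin n) k} (hs : s ∈ Wt)
    (hsr : IsReflection (s : Matrix (Fin n) (Fin n) k)) :
    matAct s (hypProd Wt α) = (↑(s⁻¹) : Matrix (Fin n) (Fin n) k).det • hypProd Wt α := by
  classical
  have hH : _ ∈ reflHyps Wt := ⟨s, hs, hsr, rfl⟩
  set H := LinearMap.ker (Matrix.toLin' (s : Matrix (Fin n) (Fin n) k) - LinearMap.id)
  obtain ⟨a, -, ha, haH⟩ := hα.exists_linForm hH
  have hθ := matAct_linForm_eq_det (s := s) (a := a) fun x hx =>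
    mem_pointStab_ker s x ((haH x).1 hx)
  set θ := (↑(s⁻¹) : Matrix (Fin n) (Fin n) k).det
  obtain ⟨χ, hχ⟩ := hα.exists_matAct_hypProd hW hs
  set π := ∏ H' ∈ (reflHyps_finite hW).toFinset.erase H, α H' with hπ
  have hδ : hypProd Wt α = α H * π := by
    rw [hypProd_eq hW, hπ, Finset.mul_prod_erase _ _ ((reflHyps_finite hW).mem_toFinset.2 hH)]
  have hndvd : ¬ α H ∣ π := by
    rw [hπ, (hα.prime hH).dvd_finsetProd_iff]
    rintro ⟨H', hH', hd⟩
    rw [Finset.mem_erase, Set.Finite.mem_toFinset] at hH'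
    exact hH'.1 (hα.eq_of_dvd hH hH'.2 hd).symm
  rw [← ha] at hθ
  have h1 : θ • matAct s π = χ • π := by
    rw [hδ, map_mul, hθ, smul_mul_assoc, ← mul_smul_comm, ← mul_smul_comm] at hχ
    exact mul_left_cancel₀ (hα.prime hH).ne_zero hχ
  have h2 : α H ∣ C (χ - θ) * π := by
    have := (hα.dvd_sub hH (mem_pointStab_ker s) π).mul_left (C θ)
    rwa [mul_sub, ← smul_eq_C_mul, h1, smul_eq_C_mul, ← sub_mul, ← C_sub] at this
  have h3 : χ = θ := by
    by_contra hne
    exact hndvd ((IsUnit.dvd_mul_left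
      ((isUnit_iff_ne_zero.2 (sub_ne_zero.2 hne)).map C)).1 h2)
  rw [hχ, h3]

end IsDefining

namespace QuotSetup

/-- The product of the root forms spans the determinant character. -/
lemma det_smul_matAct_hypProd (hs : QuotSetup Wt G p d c) (hα : IsDefining Wt α) (w : ↥Wt) :
    ((w : Matrix.GeneralLinearGroup (Fin n) k) : Matrix (Fin n) (Fin n) k).det •
      matAct w.1 (hypProd Wt α) = hypProd Wt α := by
  have hw : w ∈ Subgroup.closure (refls Wt) := hs.closure_refls ▸ Subgroup.mem_top w
  have hdet : ∀ g : Matrix.GeneralLinearGroup (Fin n) k, (g : Matrix (Fin n) (Fin n) k).det *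
      (↑(g⁻¹) : Matrix (Fin n) (Fin n) k).det = 1 := fun g => by
    rw [← Matrix.det_mul, ← Units.val_mul, mul_inv_cancel, Units.val_one, Matrix.det_one]
  induction hw using Subgroup.closure_induction with
  | mem s hsr =>
    rw [hα.matAct_hypProd_of_isReflection hs.finite s.2 hsr, smul_smul, hdet, one_smul]
  | one => rw [OneMemClass.coe_one, Units.val_one, Matrix.det_one, matAct_one, one_smul]; rfl
  | mul u v _ _ hu hv =>
    rw [Subgroup.coe_mul, Units.val_mul, Matrix.det_mul, matAct_mul, mul_smul, AlgHom.comp_apply,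
      ← map_smul, hv, hu]
  | inv u _ hu =>
    conv_lhs => rw [← hu]
    rw [InvMemClass.coe_inv, map_smul, matAct_inv_cancel', smul_smul, mul_comm, hdet, one_smul]

/-- If the class products are invariant, then so is the product of all root forms. -/
lemma hypProd_mem (hs : QuotSetup Wt G p d c)
    (hnorefl : ∀ g ∈ G, ¬ IsReflection (g : Matrix (Fin n) (Fin n) k))
    (hC : ∀ H ∈ reflHyps' Wt G, classProd Wt G α H ∈ invariants G) :
    hypProd Wt α ∈ invariants G := by
  classical
  let F : Submodule k (Fin n → k) → Set (Matrix.GeneralLinearGroup (Fin n) k) := fun H =>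
    {x | ∃ g ∈ G, ∃ u ∈ Wt ⊓ pointStab H, x = g * u}
  rw [hypProd_eq hs.finite, ← Finset.prod_fiberwise_of_maps_to
    (fun H hH => Finset.mem_image_of_mem F hH)]
  refine prod_mem fun y hy => ?_
  obtain ⟨H, hH, rfl⟩ := Finset.mem_image.1 hy
  rw [Set.Finite.mem_toFinset] at hH
  have h := hC H (reflHyps_subset_reflHyps' hnorefl hH)
  rw [classProd_eq hs.finite] at h
  convert h using 2
  ext H'
  simp only [Finset.mem_filter, Set.Finite.mem_toFinset, Set.mem_ofPred_eq]
  exact ⟨fun h => ⟨reflHyps_subset_reflHyps' hnorefl h.1, h.2.symm⟩, fun h => ⟨h.1.1, h.2.symm⟩⟩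

/-- If the class products are invariant, then `G` consists of matrices of determinant one. -/
theorem det_eq_one (hs : QuotSetup Wt G p d c)
    (hnorefl : ∀ g ∈ G, ¬ IsReflection (g : Matrix (Fin n) (Fin n) k)) (hα : IsDefining Wt α)
    (hC : ∀ H ∈ reflHyps' Wt G, classProd Wt G α H ∈ invariants G)
    {g : Matrix.GeneralLinearGroup (Fin n) k} (hg : g ∈ G) :
    (g : Matrix (Fin n) (Fin n) k).det = 1 := by
  have h := hs.det_smul_matAct_hypProd hα ⟨g, hs.le hg⟩
  rw [hs.hypProd_mem hnorefl hC g hg] at h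
  refine smul_left_injective k (hα.hypProd_ne_zero hs.finite) ?_
  exact h.trans (one_smul k _).symm

end QuotSetup

end Discriminant

/-- if `G` contains no reflection, then `G` is good in `Wt` iff
`G ⊆ SL(Vt)` and for every equivalence class `C` of `A'(Wt)`, the product
`α_C = ∏_{H ∈ C} α_H` is `G`-invariant. -/
theorem statement14 [CharZero k] {n m : ℕ}
    (Wt G : Subgroup (Matrix.GeneralLinearGroup (Fin n) k))
    (p : Fin m → MvPolynomial (Fin n) k) (d : Fin m → ℕ)
    (c : ↥Wt → Fin m → Fin m → k)
    (hsetup : QuotSetup Wt G p d c)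
    (hnorefl : ∀ g ∈ G, ¬ IsReflection ((g : Matrix (Fin n) (Fin n) k)))
    (α : Submodule k (Fin n → k) → MvPolynomial (Fin n) k)
    (hα : ∀ H ∈ reflHyps Wt, (α H).IsHomogeneous 1 ∧
      ∀ x : Fin n → k, eval x (α H) = 0 ↔ x ∈ H) :
    IsGoodQuot Wt p c ↔
      ((∀ g ∈ G, Matrix.det ((g : Matrix.GeneralLinearGroup (Fin n) k) :
          Matrix (Fin n) (Fin n) k) = 1)
        ∧ ∀ H ∈ reflHyps' Wt G,
            (∏ᶠ H' ∈ {H' | H' ∈ reflHyps' Wt G ∧ imageEq Wt G H H'}, α H')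
              ∈ invariants G) := by
  have hdef : IsDefining Wt α := hα
  refine ⟨fun h => ?_, fun h => hsetup.isGoodQuot hnorefl hdef h.2⟩
  have hC : ∀ H ∈ reflHyps' Wt G, classProd Wt G α H ∈ invariants G := fun H hH =>
    hsetup.classProd_mem hnorefl hdef h.2 hH
  exact ⟨fun g hg => hsetup.det_eq_one hnorefl hdef hC hg, hC⟩
end ReflQuot
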